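/- Let R be a left and right coherent ring and let n be a positive integer. Then the following are equivalent: (1) l.Gwdim(R) ≤ n; (2) R is n-IF; (3) r.Gwdim(R) ≤ n. -/

import Mathlib

/-!
Background definitions for D. Bennis, "Weak Gorenstein global dimensions".

Conventions.  All rings are associative with identity.  A *left* `R`-module is a type with
`[AddCommGroup M] [Module R M]`; a *right* `R`-module is a left module over the opposite ring,
i.e. `[Module Rᵐᵒᵖ M]`.  All "right-handed" notions below are obtained by applying the
corresponding "left-handed" notion to the opposite ring `Rᵐᵒᵖ`.
-/

open MulOpposite

universe u

section Tensor

variable (S : Type u) [Ring S]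

/-- The subgroup of relations defining the tensor product `A ⊗_S M` of a right `S`-module `A`
and a left `S`-module `M` over a (possibly noncommutative) ring `S`. -/
def tensorRels (A : Type u) [AddCommGroup A] [Module Sᵐᵒᵖ A]
    (M : Type u) [AddCommGroup M] [Module S M] :
    AddSubgroup (FreeAbelianGroup (A × M)) :=
  AddSubgroup.closure
    { x | (∃ a₁ a₂ m, x = FreeAbelianGroup.of (a₁ + a₂, m) - FreeAbelianGroup.of (a₁, m) -
            FreeAbelianGroup.of (a₂, m)) ∨
          (∃ a m₁ m₂, x = FreeAbelianGroup.of (a, m₁ + m₂) - FreeAbelianGroup.of (a, m₁) -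
            FreeAbelianGroup.of (a, m₂)) ∨
          (∃ (a : A) (r : S) (m : M), x = FreeAbelianGroup.of (op r • a, m) - FreeAbelianGroup.of (a, r • m)) }

/-- The tensor product `A ⊗_S M` (an abelian group) of a right `S`-module `A` and a left
`S`-module `M` over a (possibly noncommutative) ring `S`. -/
def NTensor (A : Type u) [AddCommGroup A] [Module Sᵐᵒᵖ A]
    (M : Type u) [AddCommGroup M] [Module S M] : Type u :=
  FreeAbelianGroup (A × M) ⧸ tensorRels S A M

instance (A : Type u) [AddCommGroup A] [Module Sᵐᵒᵖ A]
    (M : Type u) [AddCommGroup M] [Module S M] : AddCommGroup (NTensor S A M) :=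
  QuotientAddGroup.Quotient.addCommGroup _

namespace NTensor

variable {S}
variable {A A' : Type u} [AddCommGroup A] [Module Sᵐᵒᵖ A] [AddCommGroup A'] [Module Sᵐᵒᵖ A']
variable {M M' : Type u} [AddCommGroup M] [Module S M] [AddCommGroup M'] [Module S M']

/-- Functoriality of `A ⊗_S −` : the map `A ⊗_S M → A ⊗_S M'` induced by a linear map
`g : M → M'` of left `S`-modules. -/
def rmap (A : Type u) [AddCommGroup A] [Module Sᵐᵒᵖ A] (g : M →ₗ[S] M') :
    NTensor S A M →+ NTensor S A M' :=
  QuotientAddGroup.map (tensorRels S A M) (tensorRels S A M') (FreeAbelianGroup.map (Prod.map id g)) (by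
    simp only [tensorRels]
    refine (AddSubgroup.closure_le _).2 ?_
    rintro x (⟨a₁, a₂, m, rfl⟩ | ⟨a, m₁, m₂, rfl⟩ | ⟨a, r, m, rfl⟩) <;>
      refine SetLike.mem_coe.2 (AddSubgroup.mem_comap.2 (AddSubgroup.subset_closure ?_)) <;>
      simp only [map_sub, map_add, map_smul, FreeAbelianGroup.map_of_apply, Prod.map_apply,
        id_eq, Set.mem_setOf_eq]
    · exact Or.inl ⟨a₁, a₂, g m, rfl⟩
    · exact Or.inr (Or.inl ⟨a, g m₁, g m₂, rfl⟩)
    · exact Or.inr (Or.inr ⟨a, r, g m, rfl⟩))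

/-- Functoriality of `− ⊗_S M` : the map `A ⊗_S M → A' ⊗_S M` induced by a linear map
`f : A → A'` of right `S`-modules. -/
def lmap (M : Type u) [AddCommGroup M] [Module S M] (f : A →ₗ[Sᵐᵒᵖ] A') :
    NTensor S A M →+ NTensor S A' M :=
  QuotientAddGroup.map (tensorRels S A M) (tensorRels S A' M) (FreeAbelianGroup.map (Prod.map f id)) (by
    simp only [tensorRels]
    refine (AddSubgroup.closure_le _).2 ?_
    rintro x (⟨a₁, a₂, m, rfl⟩ | ⟨a, m₁, m₂, rfl⟩ | ⟨a, r, m, rfl⟩) <;>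
      refine SetLike.mem_coe.2 (AddSubgroup.mem_comap.2 (AddSubgroup.subset_closure ?_)) <;>
      simp only [map_sub, map_add, map_smul, FreeAbelianGroup.map_of_apply, Prod.map_apply,
        id_eq, Set.mem_setOf_eq]
    · exact Or.inl ⟨f a₁, f a₂, m, rfl⟩
    · exact Or.inr (Or.inl ⟨f a, m₁, m₂, rfl⟩)
    · exact Or.inr (Or.inr ⟨f a, r, m, rfl⟩))

end NTensor

end Tensor

section Dims

variable (S : Type u) [Ring S]

/-- A left `S`-module `M` is *flat* if tensoring with it preserves injectivity of maps of
right `S`-modules. -/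
def IsFlatMod (M : ModuleCat.{u} S) : Prop :=
  ∀ (A B : Type u) [AddCommGroup A] [Module Sᵐᵒᵖ A] [AddCommGroup B] [Module Sᵐᵒᵖ B]
    (f : A →ₗ[Sᵐᵒᵖ] B), Function.Injective f →
      Function.Injective (NTensor.lmap (↥M) f)

/-- A left `S`-module `M` is *Gorenstein flat* if there is an exact sequence
`⋯ → F (-1) → F 0 → F 1 → ⋯` of flat left `S`-modules with `M ≅ Im (F 0 → F 1)` which stays
exact after applying `I ⊗_S −` for every injective right `S`-module `I`
(a *complete flat resolution*). -/
def IsGorensteinFlat (M : ModuleCat.{u} S) : Prop :=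
  ∃ (F : ℤ → ModuleCat.{u} S) (d : ∀ n : ℤ, ↥(F n) →ₗ[S] ↥(F (n + 1))),
    (∀ n, IsFlatMod S (F n)) ∧
    (∀ n, Function.Exact (d n) (d (n + 1))) ∧
    Nonempty (↥M ≃ₗ[S] ↥(LinearMap.range (d 0))) ∧
    (∀ (I : Type u) [AddCommGroup I] [Module Sᵐᵒᵖ I], Module.Injective Sᵐᵒᵖ I →
      ∀ n, Function.Exact (NTensor.rmap I (d n)) (NTensor.rmap I (d (n + 1))))

/-- `gflatDimLE S n M` means `Gfd_S(M) ≤ n`: there is an exact sequence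
`0 → G_n → ⋯ → G_0 → M → 0` of left `S`-modules with all `G_i` Gorenstein flat. -/
def gflatDimLE : ℕ → ModuleCat.{u} S → Prop
  | 0, M => IsGorensteinFlat S M
  | n + 1, M => ∃ (K G : ModuleCat.{u} S) (ι : ↥K →ₗ[S] ↥G) (π : ↥G →ₗ[S] ↥M),
      Function.Injective ι ∧ Function.Surjective π ∧ Function.Exact ι π ∧
      IsGorensteinFlat S G ∧ gflatDimLE n K

/-- `flatDimLE S n M` means `fd_S(M) ≤ n`: there is an exact sequence
`0 → F_n → ⋯ → F_0 → M → 0` of left `S`-modules with all `F_i` flat. -/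
def flatDimLE : ℕ → ModuleCat.{u} S → Prop
  | 0, M => IsFlatMod S M
  | n + 1, M => ∃ (K F : ModuleCat.{u} S) (ι : ↥K →ₗ[S] ↥F) (π : ↥F →ₗ[S] ↥M),
      Function.Injective ι ∧ Function.Surjective π ∧ Function.Exact ι π ∧
      IsFlatMod S F ∧ flatDimLE n K

/-- `injDimLE S n M` means `id_S(M) ≤ n`: there is an exact sequence
`0 → M → I^0 → ⋯ → I^n → 0` of left `S`-modules with all `I^i` injective. -/
def injDimLE : ℕ → ModuleCat.{u} S → Prop
  | 0, M => Module.Injective S ↥M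
  | n + 1, M => ∃ (I C : ModuleCat.{u} S) (ι : ↥M →ₗ[S] ↥I) (π : ↥I →ₗ[S] ↥C),
      Function.Injective ι ∧ Function.Surjective π ∧ Function.Exact ι π ∧
      Module.Injective S ↥I ∧ injDimLE n C

/-- The Gorenstein flat dimension `Gfd_S(M) ∈ ℕ∞` of a left `S`-module `M`. -/
noncomputable def gflatDim (M : ModuleCat.{u} S) : ℕ∞ :=
  sInf {d : ℕ∞ | ∃ n : ℕ, d = n ∧ gflatDimLE S n M}

/-- The flat dimension `fd_S(M) ∈ ℕ∞` of a left `S`-module `M`. -/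
noncomputable def flatDim (M : ModuleCat.{u} S) : ℕ∞ :=
  sInf {d : ℕ∞ | ∃ n : ℕ, d = n ∧ flatDimLE S n M}

/-- The injective dimension `id_S(M) ∈ ℕ∞` of a left `S`-module `M`. -/
noncomputable def injDim (M : ModuleCat.{u} S) : ℕ∞ :=
  sInf {d : ℕ∞ | ∃ n : ℕ, d = n ∧ injDimLE S n M}

/-- The left weak Gorenstein global dimension
`l.Gwdim(S) = sup { Gfd_S(M) | M a left S-module }`.  The right weak Gorenstein global
dimension of `S` is `gorensteinWeakGlobalDim Sᵐᵒᵖ`. -/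
noncomputable def gorensteinWeakGlobalDim : ℕ∞ :=
  ⨆ M : ModuleCat.{u} S, gflatDim S M

/-- The left weak global dimension `sup { fd_S(M) | M a left S-module }`.  (By a classical
theorem it agrees with `weakGlobalDim Sᵐᵒᵖ`, and the common value is `wdim S`.) -/
noncomputable def weakGlobalDim : ℕ∞ :=
  ⨆ M : ModuleCat.{u} S, flatDim S M

/-- The left finitistic flat dimension
`l.FFD(S) = sup { fd_S(M) | M a left S-module with fd_S(M) < ∞ }`. -/
noncomputable def finitisticFlatDim : ℕ∞ :=
  sSup {d : ℕ∞ | d ≠ ⊤ ∧ ∃ M : ModuleCat.{u} S, flatDim S M = d}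

/-- The left finitistic Gorenstein flat dimension
`l.FGFD(S) = sup { Gfd_S(M) | M a left S-module with Gfd_S(M) < ∞ }`. -/
noncomputable def finitisticGFlatDim : ℕ∞ :=
  sSup {d : ℕ∞ | d ≠ ⊤ ∧ ∃ M : ModuleCat.{u} S, gflatDim S M = d}

/-- A ring `S` is *left GF-closed* if the class of Gorenstein flat left `S`-modules is closed
under extensions.  `S` is right GF-closed iff `Sᵐᵒᵖ` is left GF-closed, and GF-closed if both. -/
def IsGFClosed : Prop :=
  ∀ (A B C : ModuleCat.{u} S) (f : ↥A →ₗ[S] ↥B) (g : ↥B →ₗ[S] ↥C),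
    Function.Injective f → Function.Surjective g → Function.Exact f g →
      IsGorensteinFlat S A → IsGorensteinFlat S C → IsGorensteinFlat S B

/-- A ring `S` is *left coherent* if every finitely generated left ideal of `S` is finitely
presented (as a left `S`-module).  `S` is right coherent iff `Sᵐᵒᵖ` is left coherent. -/
def IsLeftCoherent : Prop :=
  ∀ I : Submodule S S, I.FG → Module.FinitePresentation S ↥I

/-- A ring `S` is *left IF* if every injective left `S`-module is flat.  `S` is right IF iff
`Sᵐᵒᵖ` is left IF, and IF if both. -/
def IsLeftIF : Prop :=
  ∀ E : ModuleCat.{u} S, Module.Injective S ↥E → IsFlatMod S E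

/-- A ring `S` is *left `n`-IF* if `fd_S(E) ≤ n` for every injective left `S`-module `E`.
`S` is right `n`-IF iff `Sᵐᵒᵖ` is left `n`-IF, and `n`-IF if both. -/
def IsLeftNIF (n : ℕ) : Prop :=
  ∀ E : ModuleCat.{u} S, Module.Injective S ↥E → flatDim S E ≤ (n : ℕ∞)

/-- `Ext¹_S(T, K) = 0`, expressed by its standard characterization: every extension of `T`
by `K` (i.e. every short exact sequence `0 → K → X → T → 0`) splits. -/
def Ext1Zero (T K : ModuleCat.{u} S) : Prop :=
  ∀ (X : ModuleCat.{u} S) (ι : ↥K →ₗ[S] ↥X) (π : ↥X →ₗ[S] ↥T),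
    Function.Injective ι → Function.Surjective π → Function.Exact ι π →
      ∃ ρ : ↥X →ₗ[S] ↥K, ρ.comp ι = LinearMap.id

/-- A left `S`-module `K` is *cotorsion* if `Ext¹_S(F, K) = 0` for every flat left
`S`-module `F`. -/
def IsCotorsion (K : ModuleCat.{u} S) : Prop :=
  ∀ F : ModuleCat.{u} S, IsFlatMod S F → Ext1Zero S F K

/-- `Tor₁^S(A, T) = 0` for a right `S`-module `A` and a left `S`-module `T`, expressed by its
standard characterization: for every short exact sequence `0 → K → F → T → 0` of left
`S`-modules with `F` flat, the induced map `A ⊗_S K → A ⊗_S F` is injective. -/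
def Tor1Zero (A : Type u) [AddCommGroup A] [Module Sᵐᵒᵖ A] (T : ModuleCat.{u} S) : Prop :=
  ∀ (K F : ModuleCat.{u} S) (ι : ↥K →ₗ[S] ↥F) (π : ↥F →ₗ[S] ↥T),
    IsFlatMod S F → Function.Injective ι → Function.Surjective π → Function.Exact ι π →
      Function.Injective (NTensor.rmap A ι)

/-- A left `S`-module is *finitely presented* if it admits a presentation with finitely many
generators and relations. -/
abbrev IsFinitelyPresented (M : ModuleCat.{u} S) : Prop :=
  Module.FinitePresentation S ↥M

end Dims

namespace NTensor

variable {S : Type u} [Ring S]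
variable {A A' : Type u} [AddCommGroup A] [Module Sᵐᵒᵖ A] [AddCommGroup A'] [Module Sᵐᵒᵖ A']
variable {M M' M'' : Type u} [AddCommGroup M] [Module S M] [AddCommGroup M'] [Module S M']
  [AddCommGroup M''] [Module S M'']

/-- The pure tensor `a ⊗ m`. -/
def tmul (a : A) (m : M) : NTensor S A M :=
  QuotientAddGroup.mk (FreeAbelianGroup.of (a, m))

theorem tmul_add_left (a₁ a₂ : A) (m : M) :
    tmul (S := S) (a₁ + a₂) m = tmul a₁ m + tmul a₂ m := by
  rw [← sub_eq_zero, ← sub_sub]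
  exact (QuotientAddGroup.eq_zero_iff _).2 (AddSubgroup.subset_closure (Or.inl ⟨a₁, a₂, m, rfl⟩))

theorem tmul_add_right (a : A) (m₁ m₂ : M) :
    tmul (S := S) a (m₁ + m₂) = tmul a m₁ + tmul a m₂ := by
  rw [← sub_eq_zero, ← sub_sub]
  exact (QuotientAddGroup.eq_zero_iff _).2
    (AddSubgroup.subset_closure (Or.inr (Or.inl ⟨a, m₁, m₂, rfl⟩)))

theorem smul_tmul (a : A) (r : S) (m : M) :
    tmul (S := S) (op r • a) m = tmul a (r • m) := by
  rw [← sub_eq_zero]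
  exact (QuotientAddGroup.eq_zero_iff _).2
    (AddSubgroup.subset_closure (Or.inr (Or.inr ⟨a, r, m, rfl⟩)))

theorem addHom_ext {Q : Type*} [AddCommGroup Q] {f g : NTensor S A M →+ Q}
    (h : ∀ a m, f (tmul a m) = g (tmul a m)) : f = g :=
  QuotientAddGroup.addMonoidHom_ext _ (FreeAbelianGroup.lift_ext _ _ fun x => h x.1 x.2)

/-- The additive map out of `A ⊗_S M` induced by a balanced biadditive map. -/
def lift {Q : Type*} [AddCommGroup Q] (b : A →+ M →+ Q)
    (hb : ∀ (r : S) a m, b (op r • a) m = b a (r • m)) : NTensor S A M →+ Q :=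
  QuotientAddGroup.lift (tensorRels S A M) (FreeAbelianGroup.lift fun x => b x.1 x.2) (by
    refine (AddSubgroup.closure_le _).2 ?_
    rintro x (⟨a₁, a₂, m, rfl⟩ | ⟨a, m₁, m₂, rfl⟩ | ⟨a, r, m, rfl⟩) <;>
      simp [hb])

@[simp]
theorem lift_tmul {Q : Type*} [AddCommGroup Q] (b : A →+ M →+ Q)
    (hb : ∀ (r : S) a m, b (op r • a) m = b a (r • m)) (a : A) (m : M) :
    lift b hb (tmul a m) = b a m :=
  FreeAbelianGroup.lift_apply_of _ _

@[simp]
theorem rmap_tmul (g : M →ₗ[S] M') (a : A) (m : M) :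
    rmap A g (tmul a m) = tmul a (g m) := by
  change QuotientAddGroup.mk (FreeAbelianGroup.map _ (FreeAbelianGroup.of _)) = _
  rw [FreeAbelianGroup.map_of_apply]; rfl

@[simp]
theorem lmap_tmul (f : A →ₗ[Sᵐᵒᵖ] A') (a : A) (m : M) :
    lmap M f (tmul a m) = tmul (f a) m := by
  change QuotientAddGroup.mk (FreeAbelianGroup.map _ (FreeAbelianGroup.of _)) = _
  rw [FreeAbelianGroup.map_of_apply]; rfl

theorem rmap_rmap (g : M →ₗ[S] M') (h : M' →ₗ[S] M'') (z : NTensor S A M) :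
    rmap A h (rmap A g z) = rmap A (h.comp g) z :=
  DFunLike.congr_fun (addHom_ext (f := (rmap A h).comp (rmap A g)) fun a m => by simp) z

theorem rmap_zero (z : NTensor S A M) : rmap A (0 : M →ₗ[S] M') z = 0 :=
  DFunLike.congr_fun (addHom_ext (g := 0) fun a m => by
    have h := tmul_add_right (S := S) a (0 : M') 0
    simpa using h) z

end NTensor

/-- The character module `Hom_ℤ(M, ℚ/ℤ)` of a left `S`-module, as a right `S`-module. -/
def LeftDual (S : Type u) [Ring S] (M : Type u) [AddCommGroup M] [Module S M] : Type u :=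
  M →+ AddCircle (1 : ℚ)

/-- The character module `Hom_ℤ(A, ℚ/ℤ)` of a right `S`-module, as a left `S`-module. -/
def RightDual (S : Type u) [Ring S] (A : Type u) [AddCommGroup A] [Module Sᵐᵒᵖ A] : Type u :=
  A →+ AddCircle (1 : ℚ)

/-- Characters extend along injective homomorphisms of abelian groups. -/
theorem exists_character_extension {M N : Type*} [AddCommGroup M] [AddCommGroup N]
    (f : M →+ N) (hf : Function.Injective f) (g : M →+ AddCircle (1 : ℚ)) :
    ∃ h : N →+ AddCircle (1 : ℚ), h.comp f = g :=
  (Module.Baer.of_divisible _).extension_property_addMonoidHom f hf g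

/-- A character vanishing on the kernel of `f` factors through `f`. -/
theorem exists_character_factor {M N : Type*} [AddCommGroup M] [AddCommGroup N]
    (f : M →+ N) (g : M →+ AddCircle (1 : ℚ)) (h : ∀ x, f x = 0 → g x = 0) :
    ∃ k : N →+ AddCircle (1 : ℚ), k.comp f = g := by
  obtain ⟨k, hk⟩ := exists_character_extension (QuotientAddGroup.kerLift f)
    (QuotientAddGroup.kerLift_injective f) (QuotientAddGroup.lift f.ker g h)
  refine ⟨k, AddMonoidHom.ext fun x => ?_⟩
  exact DFunLike.congr_fun hk (QuotientAddGroup.mk x)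

/-- Characters separate the points of an abelian group. -/
theorem eq_zero_of_characters {N : Type*} [AddCommGroup N] {x : N}
    (h : ∀ c : N →+ AddCircle (1 : ℚ), c x = 0) : x = 0 :=
  CharacterModule.eq_zero_of_character_apply h

/-- Characters separate the points of an abelian group from the image of a homomorphism. -/
theorem mem_range_of_characters {M N : Type*} [AddCommGroup M] [AddCommGroup N] (f : M →+ N)
    (y : N) (h : ∀ c : N →+ AddCircle (1 : ℚ), (∀ x, c (f x) = 0) → c y = 0) :
    y ∈ Set.range f := by
  change y ∈ f.range
  rw [← QuotientAddGroup.eq_zero_iff]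
  refine eq_zero_of_characters fun c => ?_
  exact h (c.comp (QuotientAddGroup.mk' f.range)) fun x => by
    have : (QuotientAddGroup.mk' f.range) (f x) = 0 :=
      (QuotientAddGroup.eq_zero_iff _).2 ⟨x, rfl⟩
    simp only [AddMonoidHom.comp_apply, this, map_zero]

section DualInstances

variable (S : Type u) [Ring S]
variable (M : Type u) [AddCommGroup M] [Module S M] (A : Type u) [AddCommGroup A] [Module Sᵐᵒᵖ A]

instance : AddCommGroup (LeftDual S M) := inferInstanceAs (AddCommGroup (M →+ AddCircle (1 : ℚ)))
instance : AddCommGroup (RightDual S A) := inferInstanceAs (AddCommGroup (A →+ AddCircle (1 : ℚ)))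
instance : FunLike (LeftDual S M) M (AddCircle (1 : ℚ)) :=
  inferInstanceAs (FunLike (M →+ AddCircle (1 : ℚ)) _ _)
instance : FunLike (RightDual S A) A (AddCircle (1 : ℚ)) :=
  inferInstanceAs (FunLike (A →+ AddCircle (1 : ℚ)) _ _)
instance : AddMonoidHomClass (LeftDual S M) M (AddCircle (1 : ℚ)) :=
  inferInstanceAs (AddMonoidHomClass (M →+ AddCircle (1 : ℚ)) _ _)
instance : AddMonoidHomClass (RightDual S A) A (AddCircle (1 : ℚ)) :=
  inferInstanceAs (AddMonoidHomClass (A →+ AddCircle (1 : ℚ)) _ _)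

variable {S M A}

@[ext] theorem LeftDual.ext {f g : LeftDual S M} (h : ∀ x, f x = g x) : f = g :=
  DFunLike.ext _ _ h
@[ext] theorem RightDual.ext {f g : RightDual S A} (h : ∀ x, f x = g x) : f = g :=
  DFunLike.ext _ _ h
@[simp] theorem LeftDual.add_apply (f g : LeftDual S M) (x : M) : (f + g) x = f x + g x := rfl
@[simp] theorem RightDual.add_apply (f g : RightDual S A) (x : A) : (f + g) x = f x + g x := rfl
@[simp] theorem LeftDual.zero_apply (x : M) : (0 : LeftDual S M) x = 0 := rfl
@[simp] theorem RightDual.zero_apply (x : A) : (0 : RightDual S A) x = 0 := rfl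

instance : Module Sᵐᵒᵖ (LeftDual S M) where
  smul r f := AddMonoidHom.comp f (DistribSMul.toAddMonoidHom M r.unop)
  one_smul f := LeftDual.ext fun x => congrArg f (one_smul S x)
  mul_smul r s f := LeftDual.ext fun x => congrArg f (mul_smul s.unop r.unop x)
  smul_zero _ := rfl
  smul_add _ _ _ := rfl
  add_smul r s f := LeftDual.ext fun x =>
    (congrArg f (add_smul r.unop s.unop x)).trans (map_add f _ _)
  zero_smul f := LeftDual.ext fun x => (congrArg f (zero_smul S x)).trans (map_zero f)

instance : Module S (RightDual S A) where
  smul r f := AddMonoidHom.comp f (DistribSMul.toAddMonoidHom A (op r))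
  one_smul f := RightDual.ext fun x => congrArg f (one_smul Sᵐᵒᵖ x)
  mul_smul r s f := RightDual.ext fun x => congrArg f (mul_smul (op s) (op r) x)
  smul_zero _ := rfl
  smul_add _ _ _ := rfl
  add_smul r s f := RightDual.ext fun x =>
    (congrArg f (add_smul (op r) (op s) x)).trans (map_add f _ _)
  zero_smul f := RightDual.ext fun x => (congrArg f (zero_smul Sᵐᵒᵖ x)).trans (map_zero f)

@[simp] theorem LeftDual.smul_apply (r : Sᵐᵒᵖ) (f : LeftDual S M) (x : M) :
    (r • f) x = f (r.unop • x) := rfl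
@[simp] theorem RightDual.smul_apply (r : S) (f : RightDual S A) (x : A) :
    (r • f) x = f (op r • x) := rfl

end DualInstances

section DualMaps

variable {S : Type u} [Ring S]
variable {M N P : Type u} [AddCommGroup M] [Module S M] [AddCommGroup N] [Module S N]
  [AddCommGroup P] [Module S P]
variable {A B C : Type u} [AddCommGroup A] [Module Sᵐᵒᵖ A] [AddCommGroup B] [Module Sᵐᵒᵖ B]
  [AddCommGroup C] [Module Sᵐᵒᵖ C]

/-- Precomposition of characters with a map of left modules. -/
def LeftDual.map (f : M →ₗ[S] N) : LeftDual S N →ₗ[Sᵐᵒᵖ] LeftDual S M where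
  toFun c := AddMonoidHom.comp c f.toAddMonoidHom
  map_add' _ _ := rfl
  map_smul' r c := LeftDual.ext fun x => congrArg c (f.map_smul r.unop x).symm

/-- Precomposition of characters with a map of right modules. -/
def RightDual.map (f : A →ₗ[Sᵐᵒᵖ] B) : RightDual S B →ₗ[S] RightDual S A where
  toFun c := AddMonoidHom.comp c f.toAddMonoidHom
  map_add' _ _ := rfl
  map_smul' r c := RightDual.ext fun x => congrArg c (f.map_smul (op r) x).symm

@[simp] theorem LeftDual.map_apply (f : M →ₗ[S] N) (c : LeftDual S N) (x : M) :
    LeftDual.map f c x = c (f x) := rfl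
@[simp] theorem RightDual.map_apply (f : A →ₗ[Sᵐᵒᵖ] B) (c : RightDual S B) (x : A) :
    RightDual.map f c x = c (f x) := rfl

theorem RightDual.map_surjective {f : A →ₗ[Sᵐᵒᵖ] B} (hf : Function.Injective f) :
    Function.Surjective (RightDual.map f) := fun c => by
  obtain ⟨k, hk⟩ := exists_character_extension f.toAddMonoidHom hf c
  exact ⟨k, hk⟩

/-- Transposition: maps `M → Hom_ℤ(A, ℚ/ℤ)` of left modules are maps `A → Hom_ℤ(M, ℚ/ℤ)` of
right modules. -/
def dualTranspose (f : M →ₗ[S] RightDual S A) : A →ₗ[Sᵐᵒᵖ] LeftDual S M where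
  toFun a := AddMonoidHom.mk' (fun m => f m a) fun m m' => by simp
  map_add' a b := LeftDual.ext fun m => map_add (f m) a b
  map_smul' r a := LeftDual.ext fun m => (DFunLike.congr_fun (f.map_smul r.unop m) a).symm

/-- The inverse of `dualTranspose`. -/
def dualUntranspose (f : A →ₗ[Sᵐᵒᵖ] LeftDual S M) : M →ₗ[S] RightDual S A where
  toFun m := AddMonoidHom.mk' (fun a => f a m) fun a a' => by simp
  map_add' a b := RightDual.ext fun m => map_add (f m) a b
  map_smul' r m := RightDual.ext fun a => (DFunLike.congr_fun (f.map_smul (op r) a) m).symm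

@[simp] theorem dualTranspose_apply (f : M →ₗ[S] RightDual S A) (a : A) (m : M) :
    dualTranspose f a m = f m a := rfl
@[simp] theorem dualUntranspose_apply (f : A →ₗ[Sᵐᵒᵖ] LeftDual S M) (a : A) (m : M) :
    dualUntranspose f m a = f a m := rfl

/-- The character of `A ⊗_S M` corresponding to a map `M → Hom_ℤ(A, ℚ/ℤ)`. -/
def tensorCharacter (f : M →ₗ[S] RightDual S A) : NTensor S A M →+ AddCircle (1 : ℚ) :=
  NTensor.lift
    (AddMonoidHom.mk' (fun a => AddMonoidHom.mk' (fun m => f m a) fun m m' => by simp)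
      fun a b => AddMonoidHom.ext fun m => map_add (f m) a b)
    fun r a m => (DFunLike.congr_fun (f.map_smul r m) a).symm

@[simp] theorem tensorCharacter_tmul (f : M →ₗ[S] RightDual S A) (a : A) (m : M) :
    tensorCharacter f (NTensor.tmul a m) = f m a :=
  NTensor.lift_tmul _ _ _ _

/-- The map `M → Hom_ℤ(A, ℚ/ℤ)` corresponding to a character of `A ⊗_S M`. -/
def ofTensorCharacter (c : NTensor S A M →+ AddCircle (1 : ℚ)) : M →ₗ[S] RightDual S A where
  toFun m := AddMonoidHom.mk' (fun a => c (NTensor.tmul a m)) fun a b => by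
    rw [NTensor.tmul_add_left, map_add]
  map_add' m n := RightDual.ext fun a =>
    (congrArg c (NTensor.tmul_add_right a m n)).trans (map_add c _ _)
  map_smul' r m := RightDual.ext fun a => congrArg c (NTensor.smul_tmul a r m).symm

@[simp] theorem ofTensorCharacter_apply (c : NTensor S A M →+ AddCircle (1 : ℚ)) (m : M) (a : A) :
    ofTensorCharacter c m a = c (NTensor.tmul a m) := rfl

/-- A left module is flat if and only if its character module is injective. -/
theorem isFlatMod_iff_injective_leftDual (M : ModuleCat.{u} S) :
    IsFlatMod S M ↔ Module.Injective Sᵐᵒᵖ (LeftDual S M) := by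
  constructor
  · refine fun h => ⟨fun X Y _ _ _ _ f hf g => ?_⟩
    obtain ⟨k, hk⟩ := exists_character_extension _ (h X Y f hf)
      (tensorCharacter (dualUntranspose g))
    refine ⟨dualTranspose (ofTensorCharacter k), fun x => LeftDual.ext fun m => ?_⟩
    simpa using DFunLike.congr_fun hk (NTensor.tmul x m)
  · intro h X Y _ _ _ _ f hf
    refine (injective_iff_map_eq_zero _).2 fun z hz => ?_
    refine eq_zero_of_characters fun c => ?_
    obtain ⟨k, hk⟩ := h.out f hf (dualTranspose (ofTensorCharacter c))
    have : c = (tensorCharacter (dualUntranspose k)).comp (NTensor.lmap M f) :=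
      NTensor.addHom_ext fun a m => by simp [hk]
    rw [this]
    exact (congrArg _ hz).trans (map_zero _)

/-- `A ⊗_S −` preserves exactness at the middle of `M → N → P` as soon as `Hom_S(−, A⁺)` does. -/
theorem rmap_exact_of_hom_exact {g : M →ₗ[S] N} {h : N →ₗ[S] P} (hgh : h.comp g = 0)
    (H : ∀ c : N →ₗ[S] RightDual S A, c.comp g = 0 → ∃ k : P →ₗ[S] RightDual S A, k.comp h = c) :
    Function.Exact (NTensor.rmap A g) (NTensor.rmap A h) := by
  intro z
  constructor
  · refine fun hz => mem_range_of_characters _ _ fun c hc => ?_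
    obtain ⟨k, hk⟩ := H (ofTensorCharacter c) (LinearMap.ext fun m => RightDual.ext fun a => by
      simpa using hc (NTensor.tmul a m))
    have : c = (tensorCharacter k).comp (NTensor.rmap A h) := NTensor.addHom_ext fun a m => by
      simpa using DFunLike.congr_fun (LinearMap.congr_fun hk m).symm a
    rw [this, AddMonoidHom.comp_apply, hz, map_zero]
  · rintro ⟨w, rfl⟩
    rw [NTensor.rmap_rmap, hgh, NTensor.rmap_zero]

theorem hom_exact_of_rmap_exact {g : M →ₗ[S] N} {h : N →ₗ[S] P}
    (H : Function.Exact (NTensor.rmap A g) (NTensor.rmap A h))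
    (c : N →ₗ[S] RightDual S A) (hc : c.comp g = 0) :
    ∃ k : P →ₗ[S] RightDual S A, k.comp h = c := by
  obtain ⟨k, hk⟩ := exists_character_factor (NTensor.rmap A h) (tensorCharacter c) (by
    intro z hz
    obtain ⟨w, rfl⟩ := (H z).1 hz
    exact DFunLike.congr_fun (NTensor.addHom_ext
      (f := (tensorCharacter c).comp (NTensor.rmap A g)) (g := 0) fun a m => by
        simpa using DFunLike.congr_fun (LinearMap.congr_fun hc m) a) w)
  refine ⟨ofTensorCharacter k, LinearMap.ext fun m => RightDual.ext fun a => ?_⟩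
  simpa using DFunLike.congr_fun hk (NTensor.tmul a m)

end DualMaps

section ShortExactSequences

variable {S : Type u} [Ring S]

/-- The sequence `0 → A → B → C → 0` is exact. -/
structure IsSES {A B C : Type u} [AddCommGroup A] [AddCommGroup B] [AddCommGroup C]
    [Module S A] [Module S B] [Module S C] (f : A →ₗ[S] B) (g : B →ₗ[S] C) : Prop where
  inj : Function.Injective f
  surj : Function.Surjective g
  exact : Function.Exact f g

theorem IsSES.leftDual {A B C : Type u} [AddCommGroup A] [AddCommGroup B] [AddCommGroup C]
    [Module S A] [Module S B] [Module S C] {f : A →ₗ[S] B} {g : B →ₗ[S] C} (h : IsSES f g) :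
    IsSES (LeftDual.map g) (LeftDual.map f) where
  inj c d hcd := LeftDual.ext fun x => by
    obtain ⟨y, rfl⟩ := h.surj x
    exact DFunLike.congr_fun hcd y
  surj c := by
    obtain ⟨k, hk⟩ := exists_character_extension f.toAddMonoidHom h.inj c
    exact ⟨k, hk⟩
  exact c := by
    constructor
    · intro hc
      obtain ⟨k, hk⟩ := exists_character_factor g.toAddMonoidHom c fun x hx => by
        obtain ⟨y, rfl⟩ := (h.exact x).1 hx
        exact DFunLike.congr_fun hc y
      exact ⟨k, hk⟩
    · rintro ⟨k, rfl⟩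
      exact LeftDual.ext fun x => (congrArg k (h.exact.apply_apply_eq_zero x)).trans (map_zero k)

end ShortExactSequences

section RingEquiv

theorem Module.Injective.of_ringEquiv_of_addEquiv {R R' : Type u} [Ring R] [Ring R'] {M M' : Type u}
    [AddCommGroup M] [AddCommGroup M'] [Module R M] [Module R' M'] (e : R ≃+* R') (φ : M ≃+ M')
    (hφ : ∀ (r : R) m, φ (r • m) = e r • φ m) (h : Module.Injective R M) :
    Module.Injective R' M' :=
  letI := RingHomInvPair.of_ringEquiv e
  letI := RingHomInvPair.of_ringEquiv e.symm
  Module.Injective.of_ringEquiv e { φ with map_smul' := hφ }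

variable {S S' : Type u} [Ring S] [Ring S']

theorem IsFlatMod.of_ringEquiv (e : S ≃+* S') {M : ModuleCat.{u} S} {M' : ModuleCat.{u} S'}
    (φ : M ≃+ M') (hφ : ∀ (r : S) m, φ (r • m) = e r • φ m) (h : IsFlatMod S M) :
    IsFlatMod S' M' := by
  rw [isFlatMod_iff_injective_leftDual] at h ⊢
  let ψ : LeftDual S M ≃+ LeftDual S' M' := φ.addMonoidHomCongrLeft
  refine h.of_ringEquiv_of_addEquiv (RingEquiv.op e) ψ ?_
  refine fun r c => LeftDual.ext fun x => congrArg c ?_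
  change r.unop • φ.symm x = φ.symm (e r.unop • x)
  rw [AddEquiv.eq_symm_apply, hφ, AddEquiv.apply_symm_apply]

theorem flatDimLE.of_ringEquiv (e : S ≃+* S') {n : ℕ} {M : ModuleCat.{u} S}
    {M' : ModuleCat.{u} S'} (φ : M ≃+ M') (hφ : ∀ (r : S) m, φ (r • m) = e r • φ m)
    (h : flatDimLE S n M) : flatDimLE S' n M' := by
  induction n generalizing M M' with
  | zero => exact IsFlatMod.of_ringEquiv e φ hφ h
  | succ n ih =>
    obtain ⟨K, F, ι, π, hι, hπ, hex, hF, hK⟩ := h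
    let tr : ModuleCat.{u} S → ModuleCat.{u} S' := fun N =>
      (ModuleCat.restrictScalars e.symm.toRingHom).obj N
    let id' (N : ModuleCat.{u} S) : N ≃+ tr N := AddEquiv.refl N
    have htr (N : ModuleCat.{u} S) (r : S) (x : N) : id' N (r • x) = e r • id' N x := by
      change r • x = (e.symm (e r)) • x
      rw [e.symm_apply_apply]
    refine ⟨tr K, tr F, { ι with map_smul' := fun r x => ι.map_smul (e.symm r) x },
      { φ.toAddMonoidHom.comp π.toAddMonoidHom with map_smul' := fun r x => ?_ },
      hι, φ.surjective.comp hπ, fun x => ?_,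
      hF.of_ringEquiv e (id' F) (htr F), ih (id' K) (htr K) hK⟩
    · refine (congrArg φ (π.map_smul (e.symm r) x)).trans ((hφ _ _).trans ?_)
      rw [e.apply_symm_apply]; rfl
    · exact (map_eq_zero_iff φ φ.injective).trans (hex x)

theorem flatDim_le_iff_exists {n : ℕ} {M : ModuleCat.{u} S} :
    flatDim S M ≤ n ↔ ∃ m ≤ n, flatDimLE S m M := by
  constructor
  · intro h
    have hne : {d : ℕ∞ | ∃ n : ℕ, d = n ∧ flatDimLE S n M}.Nonempty := by
      by_contra hc
      rw [Set.not_nonempty_iff_eq_empty] at hc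
      simp [flatDim, hc] at h
    obtain ⟨m, hm, hM⟩ := csInf_mem hne
    refine ⟨m, ?_, hM⟩
    rw [flatDim, hm] at h
    exact_mod_cast h
  · rintro ⟨m, hm, hM⟩
    have h : flatDim S M ≤ (m : ℕ∞) := sInf_le ⟨m, rfl, hM⟩
    exact h.trans (by exact_mod_cast hm)

theorem exists_gflatDimLE_of_gflatDim_le {n : ℕ} {M : ModuleCat.{u} S} (h : gflatDim S M ≤ n) :
    ∃ m ≤ n, gflatDimLE S m M := by
  have hne : {d : ℕ∞ | ∃ n : ℕ, d = n ∧ gflatDimLE S n M}.Nonempty := by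
    by_contra hc
    rw [Set.not_nonempty_iff_eq_empty] at hc
    simp [gflatDim, hc] at h
  obtain ⟨m, hm, hM⟩ := csInf_mem hne
  refine ⟨m, ?_, hM⟩
  rw [gflatDim, hm] at h
  exact_mod_cast h

theorem IsLeftNIF.of_ringEquiv (e : S ≃+* S') {n : ℕ} (h : IsLeftNIF S n) : IsLeftNIF S' n := by
  intro E hE
  let E' : ModuleCat.{u} S := (ModuleCat.restrictScalars e.toRingHom).obj E
  have hE' : Module.Injective S E' :=
    hE.of_ringEquiv_of_addEquiv e.symm (AddEquiv.refl E : E ≃+ E') fun r x => by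
      change r • x = e (e.symm r) • x
      rw [e.apply_symm_apply]
  obtain ⟨m, hm, hfd⟩ := flatDim_le_iff_exists.1 (h E' hE')
  exact flatDim_le_iff_exists.2
    ⟨m, hm, hfd.of_ringEquiv e (AddEquiv.refl E : E' ≃+ E) fun r x => rfl⟩

end RingEquiv

section Coherent

/-- Every finite family of elements of `T` has a finitely generated module of left relations. -/
def HasFiniteRelations (T : Type u) [Ring T] : Prop :=
  ∀ (ι : Type u) [Fintype ι] (a : ι → T), ∃ (m : ℕ) (r : Fin m → ι → T),
    (∀ j, ∑ i, r j i * a i = 0) ∧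
    ∀ c : ι → T, ∑ i, c i * a i = 0 → ∃ t : Fin m → T, ∀ i, c i = ∑ j, t j * r j i

theorem IsLeftCoherent.hasFiniteRelations {T : Type u} [Ring T] (h : IsLeftCoherent T) :
    HasFiniteRelations T := by
  intro ι _ a
  have hfp := h (Submodule.span T (Set.range a)) (Submodule.fg_span (Set.finite_range a))
  let L : (ι → T) →ₗ[T] T := Fintype.linearCombination T a
  have hL : LinearMap.range L = Submodule.span T (Set.range a) :=
    Fintype.range_linearCombination T a
  let L' : (ι → T) →ₗ[T] Submodule.span T (Set.range a) :=
    L.codRestrict _ fun c => hL ▸ LinearMap.mem_range_self L c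
  have hL' : Function.Surjective L' := fun ⟨x, hx⟩ => by
    rw [← hL] at hx
    obtain ⟨c, rfl⟩ := hx
    exact ⟨c, rfl⟩
  obtain ⟨m, r, hr⟩ := Submodule.fg_iff_exists_fin_generating_family.1
    (Module.FinitePresentation.fg_ker L' hL')
  have hker (c : ι → T) : c ∈ LinearMap.ker L' ↔ ∑ i, c i * a i = 0 := by
    rw [LinearMap.mem_ker, Subtype.ext_iff]
    exact Iff.of_eq rfl
  refine ⟨m, r, fun j => (hker _).1 (hr ▸ Submodule.subset_span ⟨j, rfl⟩), fun c hc => ?_⟩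
  rw [← hker, ← hr, Submodule.mem_span_range_iff_exists_fun] at hc
  obtain ⟨t, rfl⟩ := hc
  exact ⟨t, fun i => by simp⟩

theorem HasFiniteRelations.of_ringEquiv {T T' : Type u} [Ring T] [Ring T'] (e : T ≃+* T')
    (h : HasFiniteRelations T) : HasFiniteRelations T' := by
  intro ι _ a
  obtain ⟨m, r, hr, hc⟩ := h ι fun i => e.symm (a i)
  refine ⟨m, fun j i => e (r j i), fun j => ?_, fun c h0 => ?_⟩
  · simpa using congrArg e (hr j)
  · obtain ⟨t, ht⟩ := hc (fun i => e.symm (c i)) (by simpa using congrArg e.symm h0)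
    exact ⟨fun j => e (t j), fun i => by simpa using congrArg e (ht i)⟩

theorem Module.Injective.exists_factor {T X Y I : Type u} [Ring T] [AddCommGroup X]
    [AddCommGroup Y] [AddCommGroup I] [Module T X] [Module T Y] [Module T I]
    (hI : Module.Injective T I) (f : X →ₗ[T] Y) (g : X →ₗ[T] I)
    (h : LinearMap.ker f ≤ LinearMap.ker g) : ∃ k : Y →ₗ[T] I, ∀ x, k (f x) = g x := by
  obtain ⟨k, hk⟩ := hI.out ((LinearMap.ker f).liftQ f le_rfl)
    (LinearMap.ker_eq_bot.1 (Submodule.ker_liftQ_eq_bot' _ _ rfl)) ((LinearMap.ker f).liftQ g h)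
  exact ⟨k, fun x => hk (Submodule.Quotient.mk x)⟩

variable {S : Type u} [Ring S]

/-- If `S` is right coherent, then the second character module of an injective right module is
compatible with the relations between elements of `S`. -/
theorem HasFiniteRelations.sum_apply_eq_zero (hS : HasFiniteRelations Sᵐᵒᵖ) {I : Type u}
    [AddCommGroup I] [Module Sᵐᵒᵖ I] (hI : Module.Injective Sᵐᵒᵖ I) (𝔞 : Submodule Sᵐᵒᵖ Sᵐᵒᵖ)
    (h : 𝔞 →ₗ[Sᵐᵒᵖ] LeftDual S (RightDual S I)) {ι : Type u} [Fintype ι] (a : ι → 𝔞)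
    (m : ι → RightDual S I) (ham : ∑ i, (a i : Sᵐᵒᵖ).unop • m i = 0) :
    ∑ i, h (a i) (m i) = 0 := by
  classical
  obtain ⟨k, r, hr, hc⟩ := hS ι fun i => (a i : Sᵐᵒᵖ)
  let ψ : (ι → I) →+ AddCircle (1 : ℚ) :=
    ∑ i, AddMonoidHom.comp (m i : I →+ AddCircle (1 : ℚ)) (Pi.evalAddMonoidHom _ i)
  have hψ (y : ι → I) : ψ y = ∑ i, m i (y i) := by
    simp only [ψ, AddMonoidHom.finsetSum_apply]; rfl
  let ρ : (ι → I) →+ (Fin k → I) :=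
    AddMonoidHom.mk' (fun y j => ∑ i, r j i • y i) fun y z => by
      ext j; simp [smul_add, Finset.sum_add_distrib]
  obtain ⟨φ, hφ⟩ := exists_character_factor ρ ψ fun y hy => by
    obtain ⟨g, hg⟩ := hI.exists_factor
      (Fintype.linearCombination Sᵐᵒᵖ fun i => (a i : Sᵐᵒᵖ)) (Fintype.linearCombination Sᵐᵒᵖ y)
      (fun c h0 => by
        obtain ⟨t, ht⟩ := hc c h0
        have hj (j : Fin k) : ∑ i, r j i • y i = 0 := congrFun hy j
        simp only [LinearMap.mem_ker, Fintype.linearCombination_apply, ht, Finset.sum_smul]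
        rw [Finset.sum_comm]
        simp only [mul_smul, ← Finset.smul_sum, hj, smul_zero, Finset.sum_const_zero])
    have hy' (i : ι) : y i = (a i : Sᵐᵒᵖ) • g 1 := by
      have := hg (Pi.single i 1)
      simp only [Fintype.linearCombination_apply_single, one_smul] at this
      rw [← this, ← map_smul, smul_eq_mul, mul_one]
    rw [hψ]
    simp only [hy']
    have := DFunLike.congr_fun ham (g 1)
    have hsum (f : ι → RightDual S I) (x : I) : (∑ i, f i) x = ∑ i, f i x :=
      map_sum (AddMonoidHom.eval x : (I →+ AddCircle (1 : ℚ)) →+ AddCircle (1 : ℚ)) f Finset.univ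
    rw [hsum] at this
    exact this
  let φ' (j : Fin k) : RightDual S I := φ.comp (AddMonoidHom.single (fun _ => I) j)
  have hm (i : ι) : m i = ∑ j, (r j i).unop • φ' j := by
    refine RightDual.ext fun x => ?_
    have h1 : ψ (Pi.single i x) = m i x := by
      rw [hψ, Finset.sum_eq_single i] <;> simp +contextual
    have h2 : ρ (Pi.single i x) = ∑ j, Pi.single j (r j i • x) := by
      ext j
      change ∑ i', r j i' • (Pi.single i x : ι → I) i' = _
      rw [Finset.sum_eq_single i] <;> simp +contextual
    rw [← h1, ← hφ, AddMonoidHom.comp_apply, h2, map_sum]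
    exact (map_sum (AddMonoidHom.eval x : (I →+ AddCircle (1 : ℚ)) →+ AddCircle (1 : ℚ))
      (fun j => (r j i).unop • φ' j) Finset.univ).symm
  have hj (j : Fin k) : ∑ i, h (a i) ((r j i).unop • φ' j) = 0 := by
    have h0 : ∑ i, r j i • a i = 0 := Subtype.ext (by simpa using hr j)
    have := DFunLike.congr_fun (congrArg h h0) (φ' j)
    rw [map_sum, map_zero] at this
    refine Eq.trans ?_ this
    refine Eq.trans ?_ (map_sum (AddMonoidHom.eval (φ' j) :
      (RightDual S I →+ AddCircle (1 : ℚ)) →+ AddCircle (1 : ℚ))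
      (fun i => h (r j i • a i)) Finset.univ).symm
    exact Finset.sum_congr rfl fun i _ =>
      (DFunLike.congr_fun (h.map_smul (r j i) (a i)) (φ' j)).symm
  simp only [hm, map_sum]
  rw [Finset.sum_comm]
  exact Finset.sum_eq_zero fun j _ => hj j

/-- Over a right coherent ring, the character module of an injective right module is flat. -/
theorem HasFiniteRelations.isFlatMod_rightDual (hS : HasFiniteRelations Sᵐᵒᵖ) (I : Type u)
    [AddCommGroup I] [Module Sᵐᵒᵖ I] (hI : Module.Injective Sᵐᵒᵖ I) :
    IsFlatMod S (ModuleCat.of S (RightDual S I)) := by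
  rw [isFlatMod_iff_injective_leftDual]
  change Module.Injective Sᵐᵒᵖ (LeftDual S (RightDual S I))
  refine Module.Baer.injective fun 𝔞 h => ?_
  let h' (a : 𝔞) : RightDual S I →+ AddCircle (1 : ℚ) := AddMonoidHomClass.toAddMonoidHom (h a)
  obtain ⟨z, hz⟩ := exists_character_factor
    (Finsupp.liftAddHom fun a : 𝔞 => DistribSMul.toAddMonoidHom (RightDual S I) (a : Sᵐᵒᵖ).unop)
    (Finsupp.liftAddHom h') fun x hx => by
      rw [Finsupp.liftAddHom_apply, Finsupp.sum] at hx ⊢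
      rw [← Finset.sum_coe_sort] at hx ⊢
      exact hS.sum_apply_eq_zero hI 𝔞 h (fun a : x.support => (a : 𝔞)) (fun a => x a) hx
  refine ⟨LinearMap.toSpanSingleton Sᵐᵒᵖ _ (z : LeftDual S (RightDual S I)), fun a ha => ?_⟩
  refine LeftDual.ext fun m => ?_
  have := DFunLike.congr_fun hz (Finsupp.single (⟨a, ha⟩ : 𝔞) m)
  rw [AddMonoidHom.comp_apply, Finsupp.liftAddHom_apply_single,
    Finsupp.liftAddHom_apply_single] at this
  exact this

end Coherent

section ExtVanishing

open CategoryTheory Abelian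

variable {S : Type u} [Ring S]

/-- There is a short exact sequence `0 → A → B → C → 0`. -/
def HasSES (A B C : ModuleCat.{u} S) : Prop :=
  ∃ (f : A →ₗ[S] B) (g : B →ₗ[S] C), IsSES f g

theorem IsSES.comp_eq_zero {A B C : Type u} [AddCommGroup A] [AddCommGroup B] [AddCommGroup C]
    [Module S A] [Module S B] [Module S C] {f : A →ₗ[S] B} {g : B →ₗ[S] C} (h : IsSES f g) :
    g.comp f = 0 :=
  h.exact.linearMap_comp_eq_zero

theorem IsSES.shortExact {A B C : ModuleCat.{u} S} {f : A →ₗ[S] B} {g : B →ₗ[S] C}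
    (h : IsSES f g) :
    (ShortComplex.mk (ModuleCat.ofHom f) (ModuleCat.ofHom g)
      (ModuleCat.hom_ext h.comp_eq_zero)).ShortExact :=
  ModuleCat.shortComplex_shortExact _ h.exact h.inj h.surj

/-- `Ext^i_S(X, N) = 0`. -/
abbrev ExtVanish (X N : ModuleCat.{u} S) (i : ℕ) : Prop :=
  Subsingleton (Ext X N i)

variable {A B C N : ModuleCat.{u} S}

theorem ExtVanish.exists_extension {f : A →ₗ[S] B} {g : B →ₗ[S] C} (h : IsSES f g)
    (hC : ExtVanish C N 1) (k : A →ₗ[S] N) : ∃ l : B →ₗ[S] N, l.comp f = k := by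
  obtain ⟨x, hx⟩ := Ext.contravariant_sequence_exact₁ h.shortExact N
    (Ext.mk₀ (ModuleCat.ofHom k)) (add_zero 1) (hC.elim _ _)
  obtain ⟨l, rfl⟩ := (Ext.mk₀_bijective _ _).surjective x
  rw [Ext.mk₀_comp_mk₀] at hx
  have := (Ext.mk₀_bijective _ _).injective hx
  exact ⟨l.hom, congrArg ModuleCat.Hom.hom this⟩

theorem ExtVanish.of_exists_extension {f : A →ₗ[S] B} {g : B →ₗ[S] C} (h : IsSES f g)
    (hB : ExtVanish B N 1) (H : ∀ k : A →ₗ[S] N, ∃ l : B →ₗ[S] N, l.comp f = k) :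
    ExtVanish C N 1 := by
  refine subsingleton_of_forall_eq 0 fun x => ?_
  obtain ⟨y, rfl⟩ := Ext.contravariant_sequence_exact₃ h.shortExact N x (hB.elim _ _) (add_zero 1)
  obtain ⟨k, rfl⟩ := (Ext.mk₀_bijective _ _).surjective y
  obtain ⟨l, hl⟩ := H k.hom
  have hk : k = ModuleCat.ofHom f ≫ ModuleCat.ofHom l := ModuleCat.hom_ext hl.symm
  rw [hk, ← Ext.mk₀_comp_mk₀, h.shortExact.extClass_comp_assoc]

theorem HasSES.extVanish_right (h : HasSES A B C) {i : ℕ} (hA : ExtVanish A N i)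
    (hB : ExtVanish B N (i + 1)) : ExtVanish C N (i + 1) := by
  obtain ⟨f, g, h⟩ := h
  refine subsingleton_of_forall_eq 0 fun x => ?_
  obtain ⟨y, rfl⟩ := Ext.contravariant_sequence_exact₃ h.shortExact N x (hB.elim _ _)
    (add_comm 1 i)
  rw [hA.elim y 0, Ext.comp_zero]

theorem HasSES.extVanish_left (h : HasSES A B C) {i : ℕ} (hB : ExtVanish B N i)
    (hC : ExtVanish C N (i + 1)) : ExtVanish A N i := by
  obtain ⟨f, g, h⟩ := h
  refine subsingleton_of_forall_eq 0 fun x => ?_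
  obtain ⟨y, rfl⟩ := Ext.contravariant_sequence_exact₁ h.shortExact N x (add_comm 1 i)
    (hC.elim _ _)
  rw [hB.elim y 0, Ext.comp_zero]

theorem HasSES.extVanish_middle (h : HasSES A B C) {i : ℕ} (hA : ExtVanish A N i)
    (hC : ExtVanish C N i) : ExtVanish B N i := by
  obtain ⟨f, g, h⟩ := h
  refine subsingleton_of_forall_eq 0 fun x => ?_
  obtain ⟨y, rfl⟩ := Ext.contravariant_sequence_exact₂ h.shortExact N x (hA.elim _ _)
  rw [hC.elim y 0, Ext.comp_zero]

theorem ExtVanish.of_projective (P N : ModuleCat.{u} S) [Module.Projective S P] (i : ℕ) :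
    ExtVanish P N (i + 1) :=
  have := (IsProjective.iff_projective (R := S) (P := P)).1 inferInstance
  Ext.subsingleton_of_projective P N i

/-- Every module is a quotient of a projective module. -/
theorem exists_projective_hasSES (M : ModuleCat.{u} S) :
    ∃ K P : ModuleCat.{u} S, Module.Projective S P ∧ HasSES K P M := by
  let π : (M →₀ S) →ₗ[S] M := Finsupp.linearCombination S id
  exact ⟨ModuleCat.of S (LinearMap.ker π), ModuleCat.of S (M →₀ S),
    inferInstanceAs (Module.Projective S (M →₀ S)), (LinearMap.ker π).subtype, π,
    Subtype.val_injective, Finsupp.linearCombination_id_surjective S M,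
    LinearMap.exact_subtype_ker_map π⟩

theorem exists_injective_hasSES (M : ModuleCat.{u} S) :
    ∃ E C : ModuleCat.{u} S, Module.Injective S E ∧ HasSES M E C := by
  obtain ⟨E, hE, f, hf⟩ := EnoughInjectives.presentation M
  rw [ModuleCat.mono_iff_injective] at hf
  exact ⟨E, ModuleCat.of S (E ⧸ LinearMap.range f.hom), Module.injective_module_of_injective_object S E,
    f.hom, (LinearMap.range f.hom).mkQ, hf, Submodule.mkQ_surjective _,
    LinearMap.exact_map_mkQ_range f.hom⟩

end ExtVanishing

section FlatDimension

open CategoryTheory Abelian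

variable {S : Type u} [Ring S]

/-- The character module of a left module, as an object of the category of right modules. -/
abbrev dualL (M : ModuleCat.{u} S) : ModuleCat.{u} Sᵐᵒᵖ := ModuleCat.of Sᵐᵒᵖ (LeftDual S M)

/-- The character module of a right module, as an object of the category of left modules. -/
abbrev dualR (I : ModuleCat.{u} Sᵐᵒᵖ) : ModuleCat.{u} S := ModuleCat.of S (RightDual S I)

theorem HasSES.dualL {A B C : ModuleCat.{u} S} (h : HasSES A B C) :
    HasSES (dualL C) (dualL B) (dualL A) := by
  obtain ⟨f, g, h⟩ := h
  exact ⟨_, _, h.leftDual⟩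

theorem IsFlatMod.of_projective (P : ModuleCat.{u} S) [Module.Projective S P] :
    IsFlatMod S P := by
  rw [isFlatMod_iff_injective_leftDual]
  refine ⟨fun X Y _ _ _ _ f hf g => ?_⟩
  obtain ⟨k, hk⟩ := Module.projective_lifting_property (RightDual.map f) (dualUntranspose g)
    (RightDual.map_surjective hf)
  exact ⟨dualTranspose k, fun x => LeftDual.ext fun m =>
    DFunLike.congr_fun (LinearMap.congr_fun hk m) x⟩

theorem moduleInjective_iff_hasInjectiveDimensionLT (M : ModuleCat.{u} S) :
    Module.Injective S M ↔ HasInjectiveDimensionLT M 1 := by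
  rw [← injective_iff_hasInjectiveDimensionLT_one]
  exact Module.injective_iff_injective_object S M

theorem isFlatMod_iff_hasInjectiveDimensionLT (M : ModuleCat.{u} S) :
    IsFlatMod S M ↔ HasInjectiveDimensionLT (dualL M) 1 := by
  rw [isFlatMod_iff_injective_leftDual, ← moduleInjective_iff_hasInjectiveDimensionLT]

theorem HasSES.hasInjectiveDimensionLT_left {A B C : ModuleCat.{u} S} (h : HasSES A B C) {n : ℕ}
    (hC : HasInjectiveDimensionLT C n) (hB : HasInjectiveDimensionLT B (n + 1)) :
    HasInjectiveDimensionLT A (n + 1) := by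
  obtain ⟨f, g, h⟩ := h
  exact h.shortExact.hasInjectiveDimensionLT_X₁ n hC hB

theorem HasSES.hasInjectiveDimensionLT_middle {A B C : ModuleCat.{u} S} (h : HasSES A B C) {n : ℕ}
    (hA : HasInjectiveDimensionLT A n) (hC : HasInjectiveDimensionLT C n) :
    HasInjectiveDimensionLT B n := by
  obtain ⟨f, g, h⟩ := h
  exact h.shortExact.hasInjectiveDimensionLT_X₂ n hA hC

theorem HasSES.hasInjectiveDimensionLT_right {A B C : ModuleCat.{u} S} (h : HasSES A B C) {n : ℕ}
    (hB : HasInjectiveDimensionLT B n) (hA : HasInjectiveDimensionLT A (n + 1)) :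
    HasInjectiveDimensionLT C n := by
  obtain ⟨f, g, h⟩ := h
  exact h.shortExact.hasInjectiveDimensionLT_X₃ n hB hA

theorem HasSES.isFlatMod_left {A B C : ModuleCat.{u} S} (h : HasSES A B C) (hB : IsFlatMod S B)
    (hC : IsFlatMod S C) : IsFlatMod S A := by
  rw [isFlatMod_iff_hasInjectiveDimensionLT] at *
  exact h.dualL.hasInjectiveDimensionLT_right hB (hasInjectiveDimensionLT_of_ge _ 1 2 (by simp))

theorem HasSES.isFlatMod_middle {A B C : ModuleCat.{u} S} (h : HasSES A B C) (hA : IsFlatMod S A)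
    (hC : IsFlatMod S C) : IsFlatMod S B := by
  rw [isFlatMod_iff_hasInjectiveDimensionLT] at *
  exact h.dualL.hasInjectiveDimensionLT_middle hC hA

/-- The flat dimension of a module is the injective dimension of its character module. -/
theorem flatDimLE_iff_hasInjectiveDimensionLT {n : ℕ} {M : ModuleCat.{u} S} :
    flatDimLE S n M ↔ HasInjectiveDimensionLT (dualL M) (n + 1) := by
  induction n generalizing M with
  | zero => exact isFlatMod_iff_hasInjectiveDimensionLT M
  | succ n ih =>
    constructor
    · rintro ⟨K, F, ι, π, hι, hπ, hex, hF, hK⟩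
      have h : HasSES K F M := ⟨ι, π, hι, hπ, hex⟩
      rw [isFlatMod_iff_hasInjectiveDimensionLT] at hF
      exact h.dualL.hasInjectiveDimensionLT_left (ih.1 hK)
        (hasInjectiveDimensionLT_of_ge _ 1 _ (by lia))
    · intro hM
      obtain ⟨K, P, _, f, g, h⟩ := exists_projective_hasSES M
      have hP := IsFlatMod.of_projective P
      refine ⟨K, P, f, g, h.inj, h.surj, h.exact, hP, ih.2 ?_⟩
      rw [isFlatMod_iff_hasInjectiveDimensionLT] at hP
      exact HasSES.hasInjectiveDimensionLT_right (HasSES.dualL ⟨f, g, h⟩)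
        (hasInjectiveDimensionLT_of_ge _ 1 _ (by lia)) hM

theorem flatDim_le_iff_hasInjectiveDimensionLT {n : ℕ} {M : ModuleCat.{u} S} :
    flatDim S M ≤ n ↔ HasInjectiveDimensionLT (dualL M) (n + 1) := by
  rw [flatDim_le_iff_exists]
  refine ⟨fun ⟨m, hm, h⟩ => ?_, fun h => ⟨n, le_rfl, flatDimLE_iff_hasInjectiveDimensionLT.2 h⟩⟩
  rw [flatDimLE_iff_hasInjectiveDimensionLT] at h
  exact hasInjectiveDimensionLT_of_ge _ (m + 1) _ (by lia)

theorem flatDim_op_le_iff_hasInjectiveDimensionLT {n : ℕ} {I : ModuleCat.{u} Sᵐᵒᵖ} :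
    flatDim Sᵐᵒᵖ I ≤ n ↔ HasInjectiveDimensionLT (dualR I) (n + 1) := by
  rw [flatDim_le_iff_hasInjectiveDimensionLT]
  let := RingHomInvPair.of_ringEquiv (RingEquiv.opOp S)
  let := RingHomInvPair.of_ringEquiv (RingEquiv.opOp S).symm
  let φ : dualR I ≃+ dualL I := AddEquiv.refl (I →+ AddCircle (1 : ℚ))
  let ψ : dualR I ≃ₛₗ[RingHomClass.toRingHom (RingEquiv.opOp S)] dualL I :=
    { φ with map_smul' := fun r m => rfl }
  exact (ModuleCat.hasInjectiveDimensionLE_iff_of_semiLinearEquiv (RingEquiv.opOp S) ψ n).symm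

/-- `Ext^i_S(F, I⁺) = 0` for every flat left module `F` and every right module `I`. -/
theorem IsFlatMod.extVanish {F : ModuleCat.{u} S} (hF : IsFlatMod S F) (I : ModuleCat.{u} Sᵐᵒᵖ)
    (i : ℕ) : ExtVanish F (dualR I) (i + 1) := by
  induction i generalizing F with
  | zero =>
    obtain ⟨K, P, _, f, g, h⟩ := exists_projective_hasSES F
    refine ExtVanish.of_exists_extension h (ExtVanish.of_projective P _ 0) fun k => ?_
    obtain ⟨l, hl⟩ := ((isFlatMod_iff_injective_leftDual F).1 hF).out (LeftDual.map g)
      h.leftDual.inj LinearMap.id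
    obtain ⟨s, hs⟩ : ∃ s, LeftDual.map f ∘ₗ s = LinearMap.id :=
      ((h.leftDual.exact.split_tfae h.leftDual.inj h.leftDual.surj).out 0 1 :).2
        ⟨l, LinearMap.ext hl⟩
    refine ⟨dualUntranspose (s.comp (dualTranspose k)),
      LinearMap.ext fun x => RightDual.ext (S := S) (A := I) fun a => ?_⟩
    exact DFunLike.congr_fun (LinearMap.congr_fun hs (dualTranspose k a)) x
  | succ i ih =>
    obtain ⟨K, P, _, h⟩ := exists_projective_hasSES F
    exact h.extVanish_right (ih (h.isFlatMod_left (.of_projective P) hF)) (.of_projective P _ _)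

end FlatDimension

section Constructions

variable {S : Type u} [Ring S]

theorem exists_comp_eq_of_surjective {X Y Z : Type u} [AddCommGroup X] [AddCommGroup Y]
    [AddCommGroup Z] [Module S X] [Module S Y] [Module S Z] {f : X →ₗ[S] Y}
    (hf : Function.Surjective f) (g : X →ₗ[S] Z) (h : LinearMap.ker f ≤ LinearMap.ker g) :
    ∃ k : Y →ₗ[S] Z, k.comp f = g :=
  ⟨((LinearMap.ker f).liftQ g h).comp (f.quotKerEquivOfSurjective hf).symm.toLinearMap, by
    ext x
    have : (f.quotKerEquivOfSurjective hf).symm (f x) = Submodule.Quotient.mk x := by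
      rw [LinearEquiv.symm_apply_eq]; rfl
    change (LinearMap.ker f).liftQ g h ((f.quotKerEquivOfSurjective hf).symm (f x)) = g x
    rw [this]
    exact Submodule.liftQ_apply _ _ _⟩

theorem HasSES.prod (A B : ModuleCat.{u} S) : HasSES A (ModuleCat.of S (A × B)) B :=
  ⟨LinearMap.inl S A B, LinearMap.snd S A B, LinearMap.inl_injective, LinearMap.snd_surjective,
    Function.Exact.inl_snd⟩

theorem HasSES.pushout {K G M H C : ModuleCat.{u} S} (h : HasSES K G M) (h' : HasSES K H C) :
    ∃ X : ModuleCat.{u} S, HasSES G X C ∧ HasSES H X M := by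
  obtain ⟨f, g, hf, hg, hfg⟩ := h
  obtain ⟨f', g', hf', hg', hfg'⟩ := h'
  let U : Submodule S (G × H) := LinearMap.range (f.prod (-f'))
  have hU (x : G × H) : x ∈ U ↔ ∃ k, f k = x.1 ∧ -f' k = x.2 := by
    simp [U, LinearMap.mem_range, Prod.ext_iff]
  let toC : ((G × H) ⧸ U) →ₗ[S] C := U.liftQ (g'.comp (LinearMap.snd S G H)) (by
    rintro x hx
    obtain ⟨k, -, hk⟩ := (hU x).1 hx
    simp [← hk, hfg'.apply_apply_eq_zero])
  let toM : ((G × H) ⧸ U) →ₗ[S] M := U.liftQ (g.comp (LinearMap.fst S G H)) (by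
    rintro x hx
    obtain ⟨k, hk, -⟩ := (hU x).1 hx
    simp [← hk, hfg.apply_apply_eq_zero])
  refine ⟨ModuleCat.of S ((G × H) ⧸ U),
    ⟨U.mkQ.comp (LinearMap.inl S G H), toC, ?_, ?_, ?_⟩,
    ⟨U.mkQ.comp (LinearMap.inr S G H), toM, ?_, ?_, ?_⟩⟩
  · refine (injective_iff_map_eq_zero _).2 fun x hx => ?_
    obtain ⟨k, hk, hk'⟩ := (hU _).1 ((Submodule.Quotient.mk_eq_zero U).1 hx)
    have : k = 0 := (map_eq_zero_iff f' hf').1 (neg_eq_zero.1 hk')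
    simpa [this] using hk.symm
  · intro c
    obtain ⟨y, rfl⟩ := hg' c
    exact ⟨U.mkQ (0, y), rfl⟩
  · intro z
    obtain ⟨⟨x, y⟩, rfl⟩ := U.mkQ_surjective z
    constructor
    · intro hz
      obtain ⟨k, hk⟩ := (hfg' y).1 hz
      refine ⟨x + f k, (Submodule.Quotient.eq U).2 ((hU _).2 ⟨k, ?_, ?_⟩)⟩ <;> simp [hk]
    · rintro ⟨w, hw⟩
      rw [← hw]
      exact map_zero g'
  · refine (injective_iff_map_eq_zero _).2 fun x hx => ?_
    obtain ⟨k, hk, hk'⟩ := (hU _).1 ((Submodule.Quotient.mk_eq_zero U).1 hx)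
    have : k = 0 := (map_eq_zero_iff f hf).1 hk
    simpa [this] using hk'.symm
  · intro c
    obtain ⟨y, rfl⟩ := hg c
    exact ⟨U.mkQ (y, 0), rfl⟩
  · intro z
    obtain ⟨⟨x, y⟩, rfl⟩ := U.mkQ_surjective z
    constructor
    · intro hz
      obtain ⟨k, hk⟩ := (hfg x).1 hz
      refine ⟨y + f' k, (Submodule.Quotient.eq U).2 ((hU _).2 ⟨-k, ?_, ?_⟩)⟩ <;> simp [hk]
    · rintro ⟨w, hw⟩
      rw [← hw]
      exact map_zero g

theorem HasSES.third_isomorphism {H X M F C : ModuleCat.{u} S} (h : HasSES H X M)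
    (h' : HasSES X F C) : ∃ Y : ModuleCat.{u} S, HasSES H F Y ∧ HasSES M Y C := by
  obtain ⟨a, b, ha, hb, hab⟩ := h
  obtain ⟨f, g, hf, hg, hfg⟩ := h'
  let U : Submodule S F := LinearMap.range (f.comp a)
  obtain ⟨φ, hφ⟩ := exists_comp_eq_of_surjective hb (U.mkQ.comp f) fun x hx => by
    obtain ⟨y, rfl⟩ := (hab x).1 hx
    exact (Submodule.Quotient.mk_eq_zero U).2 ⟨y, rfl⟩
  replace hφ (x : X) : φ (b x) = U.mkQ (f x) := LinearMap.congr_fun hφ x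
  let toC : (F ⧸ U) →ₗ[S] C := U.liftQ g (by
    rintro _ ⟨y, rfl⟩
    exact hfg.apply_apply_eq_zero _)
  refine ⟨ModuleCat.of S (F ⧸ U), ⟨f.comp a, U.mkQ, hf.comp ha, U.mkQ_surjective,
    LinearMap.exact_map_mkQ_range _⟩, ⟨φ, toC, ?_, ?_, ?_⟩⟩
  · refine (injective_iff_map_eq_zero _).2 fun m hm => ?_
    obtain ⟨x, rfl⟩ := hb m
    rw [hφ] at hm
    obtain ⟨y, hy⟩ := (Submodule.Quotient.mk_eq_zero U).1 hm
    rw [← hf hy]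
    exact hab.apply_apply_eq_zero y
  · intro c
    obtain ⟨y, rfl⟩ := hg c
    exact ⟨U.mkQ y, rfl⟩
  · intro z
    obtain ⟨y, rfl⟩ := U.mkQ_surjective z
    constructor
    · intro hz
      obtain ⟨x, rfl⟩ := (hfg y).1 hz
      exact ⟨b x, hφ x⟩
    · rintro ⟨m, hm⟩
      obtain ⟨x, rfl⟩ := hb m
      rw [← hm, hφ]
      exact hfg.apply_apply_eq_zero x

/-- The horseshoe lemma. -/
theorem HasSES.horseshoe {M E M' K P : ModuleCat.{u} S} (h : HasSES M E M') (hK : HasSES K P M)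
    [Module.Projective S P] : ∃ K₁ P₁ K' P' : ModuleCat.{u} S, Module.Projective S P₁ ∧
      Module.Projective S P' ∧ HasSES K₁ P₁ E ∧ HasSES K' P' M' ∧ HasSES K K₁ K' := by
  obtain ⟨f, g, hf, hg, hfg⟩ := h
  obtain ⟨i, p, hi, hp, hip⟩ := hK
  obtain ⟨K', P', hP', i', p', hi', hp', hip'⟩ := exists_projective_hasSES M'
  obtain ⟨q, hq⟩ := Module.projective_lifting_property g p' hg
  replace hq (y : P') : g (q y) = p' y := LinearMap.congr_fun hq y
  let π : (P × P') →ₗ[S] E := (f.comp p).coprod q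
  have hker (y : P') (x : P) (h0 : π (x, y) = 0) : p' y = 0 := by
    have := congrArg g h0
    simpa [π, hfg.apply_apply_eq_zero, hq] using this
  let toK' : LinearMap.ker π →ₗ[S] LinearMap.ker p' :=
    LinearMap.restrict (LinearMap.snd S P P') fun x hx => hker x.2 x.1 hx
  let ι : K →ₗ[S] LinearMap.ker π :=
    ((LinearMap.inl S P P').comp i).codRestrict _ fun k => by
      simp [π, hip.apply_apply_eq_zero]
  refine ⟨ModuleCat.of S (LinearMap.ker π), ModuleCat.of S (P × P'),
    ModuleCat.of S (LinearMap.ker p'), P', inferInstanceAs (Module.Projective S (P × P')), hP',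
    ⟨(LinearMap.ker π).subtype, π, Subtype.val_injective, ?_, LinearMap.exact_subtype_ker_map π⟩,
    ⟨(LinearMap.ker p').subtype, p', Subtype.val_injective, hp',
      LinearMap.exact_subtype_ker_map p'⟩, ⟨ι, toK', ?_, ?_, ?_⟩⟩
  · intro e
    obtain ⟨y, hy⟩ := hp' (g e)
    obtain ⟨m, hm⟩ := (hfg (e - q y)).1 (by rw [map_sub, hq, hy, sub_self])
    obtain ⟨x, rfl⟩ := hp m
    exact ⟨(x, y), by simp [π, hm]⟩
  · refine (injective_iff_map_eq_zero _).2 fun k hk => ?_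
    exact (map_eq_zero_iff i hi).1 (congrArg (fun z => z.1.1) hk)
  · rintro ⟨y, hy⟩
    obtain ⟨m, hm⟩ := (hfg (q y)).1 ((hq y).trans hy)
    obtain ⟨x, rfl⟩ := hp m
    exact ⟨⟨(-x, y), by simp [π, hm]⟩, rfl⟩
  · rintro ⟨⟨x, y⟩, hxy⟩
    constructor
    · intro h0
      have hy : y = 0 := congrArg Subtype.val h0
      subst hy
      have hx : p x = 0 := (map_eq_zero_iff f hf).1 (by simpa [π] using hxy)
      obtain ⟨k, rfl⟩ := (hip x).1 hx
      exact ⟨k, rfl⟩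
    · rintro ⟨k, hk⟩
      rw [← hk]
      rfl

theorem IsSES.hasSES_prod_of_retraction {F X C G D : ModuleCat.{u} S} {α : F →ₗ[S] X}
    {β : X →ₗ[S] C} (h : IsSES α β) {ρ : X →ₗ[S] F} (hρ : ρ.comp α = LinearMap.id)
    (h' : HasSES C G D) : HasSES X (ModuleCat.of S (F × G)) D := by
  obtain ⟨j, q, hj, hq, hjq⟩ := h'
  replace hρ (x : F) : ρ (α x) = x := LinearMap.congr_fun hρ x
  refine ⟨ρ.prod (j.comp β), q.comp (LinearMap.snd S F G), ?_, ?_, ?_⟩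
  · refine (injective_iff_map_eq_zero _).2 fun x hx => ?_
    obtain ⟨y, rfl⟩ := (h.exact x).1 ((map_eq_zero_iff j hj).1 (congrArg Prod.snd hx))
    have : ρ (α y) = 0 := congrArg Prod.fst hx
    rw [← hρ y, this, map_zero]
  · exact hq.comp LinearMap.snd_surjective
  · rintro ⟨a, b⟩
    constructor
    · intro hb
      obtain ⟨c, rfl⟩ := (hjq b).1 hb
      obtain ⟨x, rfl⟩ := h.surj c
      refine ⟨x + α (a - ρ x), Prod.ext ?_ ?_⟩
      · simp [hρ]
      · change j (β (x + α (a - ρ x))) = j (β x)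
        rw [map_add, h.exact.apply_apply_eq_zero, add_zero]
    · rintro ⟨x, hx⟩
      rw [← hx]
      exact hjq.apply_apply_eq_zero _

open CategoryTheory in
/-- Over a right coherent ring, a flat left module embeds into its second character module with
flat cokernel. -/
theorem IsFlatMod.exists_hasSES_bidual (hS : HasFiniteRelations Sᵐᵒᵖ) {F : ModuleCat.{u} S}
    (hF : IsFlatMod S F) : IsFlatMod S (dualR (dualL F)) ∧
      ∃ C : ModuleCat.{u} S, IsFlatMod S C ∧ HasSES F (dualR (dualL F)) C := by
  have hF₂ : IsFlatMod S (dualR (dualL F)) :=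
    hS.isFlatMod_rightDual _ ((isFlatMod_iff_injective_leftDual F).1 hF)
  let η : F →ₗ[S] dualR (dualL F) := dualUntranspose LinearMap.id
  have hη : IsSES η (LinearMap.range η).mkQ :=
    ⟨(injective_iff_map_eq_zero _).2 fun x hx =>
      eq_zero_of_characters fun c => DFunLike.congr_fun (F := RightDual S (LeftDual S F)) hx c,
      Submodule.mkQ_surjective _, LinearMap.exact_map_mkQ_range η⟩
  refine ⟨hF₂, ModuleCat.of S (_ ⧸ LinearMap.range η), ?_, η, _, hη⟩
  obtain ⟨l, hl⟩ : ∃ l, l ∘ₗ LeftDual.map (LinearMap.range η).mkQ = LinearMap.id :=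
    ((hη.leftDual.exact.split_tfae hη.leftDual.inj hη.leftDual.surj).out 0 1 :).1
      ⟨dualTranspose LinearMap.id, rfl⟩
  rw [isFlatMod_iff_hasInjectiveDimensionLT] at hF₂ ⊢
  exact (Retract.mk (ModuleCat.ofHom (LeftDual.map (LinearMap.range η).mkQ)) (ModuleCat.ofHom l)
    (ModuleCat.hom_ext hl)).hasInjectiveDimensionLT 1

end Constructions

section GorensteinFlat

open CategoryTheory

variable {S : Type u} [Ring S]

/-- A class of left modules in which every module is both a flat syzygy and a flat cosyzygy of
modules of the class, and which is `Ext¹`-orthogonal to the character modules of injective right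
modules. -/
structure IsGorensteinFlatClass (𝒞 : ModuleCat.{u} S → Prop) : Prop where
  coresolve : ∀ Z, 𝒞 Z → ∃ F Z', IsFlatMod S F ∧ 𝒞 Z' ∧ HasSES Z F Z'
  resolve : ∀ Z, 𝒞 Z → ∃ F Z', IsFlatMod S F ∧ 𝒞 Z' ∧ HasSES Z' F Z
  ext : ∀ Z, 𝒞 Z → ∀ I : ModuleCat.{u} Sᵐᵒᵖ, Module.Injective Sᵐᵒᵖ I → ExtVanish Z (dualR I) 1

/-- A relation which is total on both sides admits bi-infinite chains. -/
theorem exists_int_chain {α : Type*} {r : α → α → Prop} (hs : ∀ a, ∃ b, r a b)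
    (hp : ∀ b, ∃ a, r a b) (a : α) : ∃ z : ℤ → α, z (0 + 1) = a ∧ ∀ n, r (z n) (z (n + 1)) := by
  choose s hs using hs
  choose p hp using hp
  refine ⟨fun n => if 1 ≤ n then s^[(n - 1).toNat] a else p^[(1 - n).toNat] a, by simp,
    fun n => ?_⟩
  rcases lt_trichotomy n 0 with hn | rfl | hn
  · have h : (1 - n).toNat = (1 - (n + 1)).toNat + 1 := by lia
    simp only [show ¬ 1 ≤ n by lia, show ¬ 1 ≤ n + 1 by lia, if_false, h,
      Function.iterate_succ_apply']
    exact hp _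
  · simpa using hp a
  · have h : (n + 1 - 1).toNat = (n - 1).toNat + 1 := by lia
    simp only [show 1 ≤ n by lia, show 1 ≤ n + 1 by lia, if_true, h,
      Function.iterate_succ_apply']
    exact hs _

theorem IsGorensteinFlatClass.isGorensteinFlat {𝒞 : ModuleCat.{u} S → Prop}
    (h𝒞 : IsGorensteinFlatClass 𝒞) {M : ModuleCat.{u} S} (hM : 𝒞 M) : IsGorensteinFlat S M := by
  obtain ⟨Z, hZ, hr⟩ := exists_int_chain (α := {Z // 𝒞 Z})
    (r := fun Z Z' => ∃ F, IsFlatMod S F ∧ HasSES Z.1 F Z'.1)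
    (fun Z => by
      obtain ⟨F, Z', hF, hZ', h⟩ := h𝒞.coresolve Z.1 Z.2
      exact ⟨⟨Z', hZ'⟩, F, hF, h⟩)
    (fun Z => by
      obtain ⟨F, Z', hF, hZ', h⟩ := h𝒞.resolve Z.1 Z.2
      exact ⟨⟨Z', hZ'⟩, F, hF, h⟩) ⟨M, hM⟩
  choose F hF ι π h using hr
  let d (n : ℤ) : F n →ₗ[S] F (n + 1) := (ι (n + 1)).comp (π n)
  have hrange (n : ℤ) : LinearMap.range (d n) = LinearMap.range (ι (n + 1)) :=
    LinearMap.range_comp_of_range_eq_top _ (LinearMap.range_eq_top.2 (h n).surj)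
  have hex (n : ℤ) : Function.Exact (d n) (d (n + 1)) := fun x => by
    change ι (n + 1 + 1) (π (n + 1) x) = 0 ↔ x ∈ LinearMap.range (d n)
    rw [hrange, map_eq_zero_iff _ (h _).inj]
    exact (h (n + 1)).exact x
  refine ⟨F, d, hF, hex, ?_, fun I _ _ hI n => ?_⟩
  · have : Nonempty (M ≃ₗ[S] (Z (0 + 1)).1) := by
      rw [hZ]
      exact ⟨LinearEquiv.refl S M⟩
    exact this.map fun e => (e.trans (LinearEquiv.ofInjective _ (h (0 + 1)).inj)).trans
      (LinearEquiv.ofEq _ _ (hrange 0).symm)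
  · refine rmap_exact_of_hom_exact (hex n).linearMap_comp_eq_zero fun c hc => ?_
    obtain ⟨k, hk⟩ := exists_comp_eq_of_surjective (h (n + 1)).surj c fun x hx => by
      obtain ⟨z, rfl⟩ := ((h (n + 1)).exact x).1 hx
      obtain ⟨y, rfl⟩ := (h n).surj z
      exact LinearMap.congr_fun hc y
    obtain ⟨l, hl⟩ := (h𝒞.ext _ (Z (n + 1 + 1 + 1)).2 (ModuleCat.of Sᵐᵒᵖ I) hI).exists_extension
      (h (n + 1 + 1)) k
    exact ⟨l, by rw [← hk, ← hl]; rfl⟩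

theorem IsGorensteinFlat.exists_class {M : ModuleCat.{u} S} (hM : IsGorensteinFlat S M) :
    ∃ 𝒞 : ModuleCat.{u} S → Prop, IsGorensteinFlatClass 𝒞 ∧ 𝒞 M := by
  obtain ⟨F, d, hF, hex, ⟨e⟩, hI⟩ := hM
  have ses (i : ℤ) (Z : ModuleCat.{u} S) (e : Z ≃ₗ[S] LinearMap.range (d (i + 1))) :
      IsSES (LinearMap.range (d i)).subtype (e.symm.toLinearMap.comp (d (i + 1)).rangeRestrict) := by
    refine ⟨Subtype.val_injective, e.symm.surjective.comp (d (i + 1)).surjective_rangeRestrict,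
      fun x => ?_⟩
    change e.symm ((d (i + 1)).rangeRestrict x) = 0 ↔ _
    rw [LinearEquiv.map_eq_zero_iff, Subtype.ext_iff]
    simpa using hex i x
  refine ⟨fun Z => ∃ j, Nonempty (Z ≃ₗ[S] LinearMap.range (d j)), ⟨?_, ?_, ?_⟩, 0, ⟨e⟩⟩
  · rintro Z ⟨j, ⟨e⟩⟩
    refine ⟨F (j + 1), ModuleCat.of S (LinearMap.range (d (j + 1))), hF _,
      ⟨j + 1, ⟨LinearEquiv.refl S _⟩⟩, ?_⟩
    have h := ses j (ModuleCat.of S (LinearMap.range (d (j + 1)))) (LinearEquiv.refl S _)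
    refine ⟨(LinearMap.range (d j)).subtype.comp e.toLinearMap, _, h.inj.comp e.injective, h.surj,
      fun x => (h.exact x).trans ?_⟩
    exact (e.surjective.range_comp (LinearMap.range (d j)).subtype).symm ▸ Iff.rfl
  · rintro Z ⟨j, ⟨e⟩⟩
    obtain ⟨i, rfl⟩ : ∃ i, j = i + 1 := ⟨j - 1, by lia⟩
    exact ⟨F (i + 1), ModuleCat.of S (LinearMap.range (d i)), hF _, ⟨i, ⟨LinearEquiv.refl S _⟩⟩,
      _, _, ses i Z e⟩
  · rintro Z ⟨j, ⟨e⟩⟩ I hinj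
    obtain ⟨i, rfl⟩ : ∃ i, j = i + 1 + 1 := ⟨j - 2, by lia⟩
    refine ExtVanish.of_exists_extension (A := ModuleCat.of S (LinearMap.range (d (i + 1))))
      (ses (i + 1) Z e) ((hF _).extVanish I 0) fun k => ?_
    obtain ⟨l, hl⟩ := hom_exact_of_rmap_exact (hI I hinj i) (k.comp (d (i + 1)).rangeRestrict)
      (LinearMap.ext fun x => by
        have : (d (i + 1)).rangeRestrict (d i x) = 0 :=
          Subtype.ext ((hex i).apply_apply_eq_zero x)
        simp [this])
    refine ⟨l, LinearMap.ext fun x => ?_⟩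
    obtain ⟨y, rfl⟩ := (d (i + 1)).surjective_rangeRestrict x
    exact LinearMap.congr_fun hl y

theorem IsFlatMod.isGorensteinFlat {F : ModuleCat.{u} S} (hF : IsFlatMod S F) :
    IsGorensteinFlat S F := by
  have h0 : IsFlatMod S (ModuleCat.of S PUnit) :=
    have : Module.Projective S (ModuleCat.of S PUnit) :=
      inferInstanceAs (Module.Projective S PUnit)
    .of_projective _
  refine IsGorensteinFlatClass.isGorensteinFlat (𝒞 := IsFlatMod S)
    ⟨fun Z hZ => ⟨Z, ModuleCat.of S PUnit, hZ, h0, LinearMap.id, 0, Function.injective_id,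
        fun _ => ⟨0, Subsingleton.elim _ _⟩, fun x => ⟨fun _ => ⟨x, rfl⟩, fun _ => rfl⟩⟩,
      fun Z hZ => ⟨Z, ModuleCat.of S PUnit, hZ, h0, 0, LinearMap.id,
        Function.injective_of_subsingleton _, Function.surjective_id,
        fun x => ⟨fun hx => ⟨0, hx.symm⟩, fun ⟨_, hx⟩ => hx.symm⟩⟩,
      fun Z hZ I _ => hZ.extVanish I 0⟩ hF

theorem IsGorensteinFlat.extVanish {G : ModuleCat.{u} S} (hG : IsGorensteinFlat S G)
    {I : ModuleCat.{u} Sᵐᵒᵖ} (hI : Module.Injective Sᵐᵒᵖ I) (i : ℕ) :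
    ExtVanish G (dualR I) (i + 1) := by
  obtain ⟨𝒞, h𝒞, hG𝒞⟩ := hG.exists_class
  clear hG
  induction i generalizing G with
  | zero => exact h𝒞.ext G hG𝒞 I hI
  | succ i ih =>
    obtain ⟨F, Z, hF, hZ, h⟩ := h𝒞.resolve G hG𝒞
    exact h.extVanish_right (ih hZ) (hF.extVanish I _)

theorem gflatDimLE.extVanish {m : ℕ} {M : ModuleCat.{u} S} (hM : gflatDimLE S m M)
    {I : ModuleCat.{u} Sᵐᵒᵖ} (hI : Module.Injective Sᵐᵒᵖ I) (i : ℕ) :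
    ExtVanish M (dualR I) (i + m + 1) := by
  induction m generalizing M with
  | zero => exact IsGorensteinFlat.extVanish hM hI i
  | succ m ih =>
    obtain ⟨K, G, ι, π, hι, hπ, hex, hG, hK⟩ := hM
    exact HasSES.extVanish_right ⟨ι, π, hι, hπ, hex⟩ (ih hK) (hG.extVanish hI _)

theorem isLeftNIF_op_of_gorensteinWeakGlobalDim_le {n : ℕ}
    (h : gorensteinWeakGlobalDim S ≤ n) : IsLeftNIF Sᵐᵒᵖ n := by
  intro I hI
  rw [flatDim_op_le_iff_hasInjectiveDimensionLT]
  refine hasInjectiveDimensionLT_of_enoughProjectives _ _ fun M => ?_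
  obtain ⟨m, hm, hM⟩ := exists_gflatDimLE_of_gflatDim_le (iSup_le_iff.1 h M)
  have := hM.extVanish hI (n - m)
  rwa [Nat.sub_add_cancel hm] at this

/-- Iterated extensions of Gorenstein flat modules. -/
inductive GorensteinFlatFiltered : ModuleCat.{u} S → Prop
  | of {M : ModuleCat.{u} S} (hM : IsGorensteinFlat S M) : GorensteinFlatFiltered M
  | ext {A B C : ModuleCat.{u} S} (h : HasSES A B C) (hA : GorensteinFlatFiltered A)
    (hC : GorensteinFlatFiltered C) : GorensteinFlatFiltered B

theorem GorensteinFlatFiltered.extVanish {M : ModuleCat.{u} S} (hM : GorensteinFlatFiltered M)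
    {I : ModuleCat.{u} Sᵐᵒᵖ} (hI : Module.Injective Sᵐᵒᵖ I) : ExtVanish M (dualR I) 1 := by
  induction hM with
  | of hM => exact hM.extVanish hI 0
  | ext h _ _ ihA ihC => exact h.extVanish_middle ihA ihC

theorem GorensteinFlatFiltered.exists_cosyzygy (hS : HasFiniteRelations Sᵐᵒᵖ)
    {M : ModuleCat.{u} S} (hM : GorensteinFlatFiltered M) :
    ∃ F M' : ModuleCat.{u} S, IsFlatMod S F ∧ GorensteinFlatFiltered M' ∧ HasSES M F M' := by
  induction hM with
  | of hM =>
    obtain ⟨𝒞, h𝒞, hM⟩ := hM.exists_class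
    obtain ⟨F, M', hF, hM', h⟩ := h𝒞.coresolve _ hM
    exact ⟨F, M', hF, .of (h𝒞.isGorensteinFlat hM'), h⟩
  | ext h _ hC ihA ihC =>
    obtain ⟨F, A', hF, hA', hA⟩ := ihA
    obtain ⟨G, C', hG, hC', hCG⟩ := ihC
    obtain ⟨hF₂, Q, hQ, hFQ⟩ := hF.exists_hasSES_bidual hS
    obtain ⟨A₂, hA₂, hAQ⟩ := hA.third_isomorphism hFQ
    obtain ⟨X, ⟨α, β, hαβ⟩, hX⟩ := hA₂.pushout h
    obtain ⟨ρ, hρ⟩ := ExtVanish.exists_extension hαβ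
      (hC.extVanish ((isFlatMod_iff_injective_leftDual F).1 hF)) LinearMap.id
    obtain ⟨Y, hY, hY'⟩ := hX.third_isomorphism (hαβ.hasSES_prod_of_retraction hρ hCG)
    exact ⟨_, Y, (HasSES.prod _ G).isFlatMod_middle hF₂ hG,
      .ext hY' (.ext hAQ hA' (.of hQ.isGorensteinFlat)) hC', hY⟩

theorem gflatDimLE.exists_hasSES (hS : HasFiniteRelations Sᵐᵒᵖ) {m : ℕ} {M : ModuleCat.{u} S}
    (hM : gflatDimLE S m M) : ∃ H C : ModuleCat.{u} S,
      HasInjectiveDimensionLT (dualL H) (m + 1) ∧ GorensteinFlatFiltered C ∧ HasSES M H C := by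
  induction m generalizing M with
  | zero =>
    obtain ⟨F, M', hF, hM', h⟩ := (GorensteinFlatFiltered.of hM).exists_cosyzygy hS
    exact ⟨F, M', (isFlatMod_iff_hasInjectiveDimensionLT F).1 hF, hM', h⟩
  | succ m ih =>
    obtain ⟨K, G, ι, π, hι, hπ, hex, hG, hK⟩ := hM
    obtain ⟨H, C, hH, hC, hKH⟩ := ih hK
    obtain ⟨X, hX, hX'⟩ := HasSES.pushout ⟨ι, π, hι, hπ, hex⟩ hKH
    obtain ⟨F, X', hF, hX'', hXF⟩ := (GorensteinFlatFiltered.ext hX (.of hG) hC).exists_cosyzygy hS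
    obtain ⟨Y, hY, hY'⟩ := hX'.third_isomorphism hXF
    rw [isFlatMod_iff_hasInjectiveDimensionLT] at hF
    exact ⟨Y, X', hY.dualL.hasInjectiveDimensionLT_left hH
      (hasInjectiveDimensionLT_of_ge _ 1 _ (by lia)), hX'', hY'⟩

theorem isLeftNIF_of_gorensteinWeakGlobalDim_le (hS : HasFiniteRelations Sᵐᵒᵖ) {n : ℕ}
    (h : gorensteinWeakGlobalDim S ≤ n) : IsLeftNIF S n := by
  intro E hE
  obtain ⟨m, hm, hEm⟩ := exists_gflatDimLE_of_gflatDim_le (iSup_le_iff.1 h E)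
  obtain ⟨H, C, hH, -, f, g, hfg⟩ := hEm.exists_hasSES hS
  obtain ⟨r, hr⟩ := hE.out f hfg.inj LinearMap.id
  have : HasInjectiveDimensionLT (dualL E) (m + 1) :=
    (Retract.mk (Y := dualL H) (ModuleCat.ofHom (LeftDual.map r)) (ModuleCat.ofHom (LeftDual.map f))
      (ModuleCat.hom_ext (LinearMap.ext fun c => LeftDual.ext fun x =>
        congrArg c (hr x)))).hasInjectiveDimensionLT _
  rw [flatDim_le_iff_hasInjectiveDimensionLT]
  exact hasInjectiveDimensionLT_of_ge _ (m + 1) _ (by lia)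

end GorensteinFlat

section Syzygy

open CategoryTheory

variable {S : Type u} [Ring S]

/-- `IsSyzygy n K M` : the module `K` is an `n`-th syzygy of `M` in some projective resolution. -/
inductive IsSyzygy : ℕ → ModuleCat.{u} S → ModuleCat.{u} S → Prop
  | zero (M : ModuleCat.{u} S) : IsSyzygy 0 M M
  | succ {n : ℕ} {K M' P M : ModuleCat.{u} S} (hP : Module.Projective S P) (h : HasSES M' P M)
    (hK : IsSyzygy n K M') : IsSyzygy (n + 1) K M

theorem exists_isSyzygy (n : ℕ) (M : ModuleCat.{u} S) : ∃ K, IsSyzygy n K M := by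
  induction n generalizing M with
  | zero => exact ⟨M, .zero M⟩
  | succ n ih =>
    obtain ⟨M', P, hP, h⟩ := exists_projective_hasSES M
    obtain ⟨K, hK⟩ := ih M'
    exact ⟨K, .succ hP h hK⟩

namespace IsSyzygy

variable {n : ℕ} {K M : ModuleCat.{u} S}

theorem horseshoe (hK : IsSyzygy n K M) {E M' : ModuleCat.{u} S} (h : HasSES M E M') :
    ∃ L K', IsSyzygy n L E ∧ IsSyzygy n K' M' ∧ HasSES K L K' := by
  induction hK generalizing E M' with
  | zero M => exact ⟨E, M', .zero E, .zero M', h⟩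
  | succ hP hM _ ih =>
    obtain ⟨E₁, P₁, M₁, P', hP₁, hP', hE, hM', h₁⟩ := h.horseshoe hM
    obtain ⟨L, K', hL, hK', h₂⟩ := ih h₁
    exact ⟨L, K', .succ hP₁ hE hL, .succ hP' hM' hK', h₂⟩

/-- A first syzygy of an `n`-th syzygy of `M` is an `n`-th syzygy of a first syzygy of `M`. -/
theorem exists_of_hasSES (hK : IsSyzygy n K M) {L P : ModuleCat.{u} S}
    (hP : Module.Projective S P) (h : HasSES L P K) :
    ∃ M' Q : ModuleCat.{u} S, Module.Projective S Q ∧ HasSES M' Q M ∧ IsSyzygy n L M' := by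
  induction hK with
  | zero M => exact ⟨L, P, hP, h, .zero L⟩
  | succ hQ hM _ ih =>
    obtain ⟨M', Q, hQ', hM', hL⟩ := ih h
    exact ⟨_, _, hQ, hM, .succ hQ' hM' hL⟩

theorem extVanish (hK : IsSyzygy n K M) {N : ModuleCat.{u} S} {i : ℕ}
    (hM : ExtVanish M N (i + 1 + n)) : ExtVanish K N (i + 1) := by
  induction hK with
  | zero M => exact hM
  | @succ n _ _ P _ hP h _ ih =>
    exact ih (h.extVanish_left
      (by rw [show i + 1 + n = i + n + 1 by lia]; exact .of_projective P N _) hM)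

theorem hasInjectiveDimensionLT_dualL (hK : IsSyzygy n K M)
    (hM : HasInjectiveDimensionLT (dualL M) (n + 1)) : HasInjectiveDimensionLT (dualL K) 1 := by
  induction hK with
  | zero M => exact hM
  | @succ n _ _ P _ hP h _ ih =>
    have := (isFlatMod_iff_hasInjectiveDimensionLT P).1 (.of_projective P)
    exact ih (h.dualL.hasInjectiveDimensionLT_right
      (hasInjectiveDimensionLT_of_ge _ 1 _ (by lia)) hM)

theorem gflatDimLE (hK : IsSyzygy n K M) (hG : IsGorensteinFlat S K) : gflatDimLE S n M := by
  induction hK with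
  | zero M => exact hG
  | @succ n _ M' P _ hP h _ ih =>
    obtain ⟨f, g, h⟩ := h
    exact ⟨M', P, f, g, h.inj, h.surj, h.exact, (IsFlatMod.of_projective P).isGorensteinFlat,
      ih hG⟩

end IsSyzygy

theorem isGorensteinFlatClass_isSyzygy {n : ℕ} (hl : IsLeftNIF S n) (hr : IsLeftNIF Sᵐᵒᵖ n) :
    IsGorensteinFlatClass (S := S) fun K => ∃ M, IsSyzygy n K M where
  coresolve := by
    rintro K ⟨M, hK⟩
    obtain ⟨E, M', hE, h⟩ := exists_injective_hasSES M
    obtain ⟨L, K', hL, hK', h'⟩ := hK.horseshoe h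
    refine ⟨L, K', ?_, ⟨M', hK'⟩, h'⟩
    exact (isFlatMod_iff_hasInjectiveDimensionLT L).2 (hL.hasInjectiveDimensionLT_dualL
      (flatDim_le_iff_hasInjectiveDimensionLT.1 (hl E hE)))
  resolve := by
    rintro K ⟨M, hK⟩
    obtain ⟨L, P, hP, h⟩ := exists_projective_hasSES K
    obtain ⟨M', -, -, -, hL⟩ := hK.exists_of_hasSES hP h
    exact ⟨P, L, .of_projective P, ⟨M', hL⟩, h⟩
  ext := by
    rintro K ⟨M, hK⟩ I hI
    have := flatDim_op_le_iff_hasInjectiveDimensionLT.1 (hr I hI)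
    exact hK.extVanish (i := 0) (HasInjectiveDimensionLT.subsingleton _ (n + 1) _ (by lia) M)

theorem gorensteinWeakGlobalDim_le_of_isLeftNIF {n : ℕ} (hl : IsLeftNIF S n)
    (hr : IsLeftNIF Sᵐᵒᵖ n) : gorensteinWeakGlobalDim S ≤ n := by
  refine iSup_le fun M => sInf_le ⟨n, rfl, ?_⟩
  obtain ⟨K, hK⟩ := exists_isSyzygy n M
  exact hK.gflatDimLE ((isGorensteinFlatClass_isSyzygy hl hr).isGorensteinFlat ⟨M, hK⟩)

end Syzygy

/-- **Theorem 2.8.**  If `R` is a left and right coherent ring and `n` is a positive integer,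
then the following are equivalent: (1) `l.Gwdim(R) ≤ n`; (2) `R` is `n`-IF (that is, both left
`n`-IF and right `n`-IF); (3) `r.Gwdim(R) ≤ n`. -/
theorem gorensteinWeakGlobalDim_le_iff_nIF_of_coherent (R : Type u) [Ring R]
    (hl : IsLeftCoherent R) (hr : IsLeftCoherent Rᵐᵒᵖ) (n : ℕ) (hn : 0 < n) :
    List.TFAE
      [gorensteinWeakGlobalDim R ≤ (n : ℕ∞),
       IsLeftNIF R n ∧ IsLeftNIF Rᵐᵒᵖ n,
       gorensteinWeakGlobalDim Rᵐᵒᵖ ≤ (n : ℕ∞)] := by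
  tfae_have 1 → 2 := fun h =>
    ⟨isLeftNIF_of_gorensteinWeakGlobalDim_le hr.hasFiniteRelations h,
      isLeftNIF_op_of_gorensteinWeakGlobalDim_le h⟩
  tfae_have 2 → 1 := fun h => gorensteinWeakGlobalDim_le_of_isLeftNIF h.1 h.2
  tfae_have 3 → 2 := fun h =>
    ⟨(isLeftNIF_op_of_gorensteinWeakGlobalDim_le h).of_ringEquiv (RingEquiv.opOp R).symm,
      isLeftNIF_of_gorensteinWeakGlobalDim_le
        (hl.hasFiniteRelations.of_ringEquiv (RingEquiv.opOp R)) h⟩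
  tfae_have 2 → 3 := fun h =>
    gorensteinWeakGlobalDim_le_of_isLeftNIF h.2 (h.1.of_ringEquiv (RingEquiv.opOp R))
  tfae_finish
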